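/- **Setting.** Let $L,n\ge 1$ and $K\ge 2$. A convolutional feedforward architecture of depth $L$ consists of positive integers $U_l,w_l,O_l$ ($0\le l\le L$) and $m_l,d_l$ ($1\le l\le L$), with $U_L=K$ and $w_L=1$ (the last layer consists of the $K$ class scores); ordered index sets (patches) $S^{l,1},\dots,S^{l,O_l}\subset\{1,\dots,U_l\}\times\{1,\dots,w_l\}$ ($0\le l\le L$), those at a given layer $l$ having a common cardinality, equal to $d_{l+1}$ for $l<L$; and nonlinearities $G_l:\mathbb R^{m_l\times O_{l-1}}\to\mathbb R^{U_l\times w_l}$ ($1\le l\le L$). A network is a tuple $\mathcal A=(A^1,\dots,A^L)$ of filter matrices $A^l\in\mathbb R^{m_l\times d_l}$; with $\Lambda_{A^l}(x)_{j,o}=\sum_{i=1}^{d_l}x_{S^{l-1,o}_i}A^l_{j,i}$ it computes $F_{\mathcal A}=G_L\circ\Lambda_{A^L}\circ\dots\circ G_1\circ\Lambda_{A^1}$, and $F^{l_1\to l_2}_{\mathcal A}$ denotes the subnetwork from the layer-$l_1$ to the layer-$l_2$ activations ($F^{l\to l}_{\mathcal A}=\mathrm{id}$). On $\mathbb R^{U_l\times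 w_l}$ let $|x|_l=\max_{o}\big(\sum_i x_{S^{l,o}_i}^2\big)^{1/2}$ and $|x|_{\infty,l}=\max_{j\le w_l}\big(\sum_{u}x_{u,j}^2\big)^{1/2}$. Assume that - every output coordinate lies in at least one of the patches $S^{L,o}$ (so $|\cdot|_L$ is a norm; for singleton patches it is the $\ell^\infty$ norm of the scores); - the nonlinearities are $1$-Lipschitz and do not mix channels, in the sense that for all $z,z'$: $|G_l(z)-G_l(z')|_{\infty,l}\le\big(\sum_{j=1}^{m_l}\max_{o}|z_{j,o}-z'_{j,o}|^2\big)^{1/2}$ (as holds for ReLU composed with max pooling over spatial positions). Let $\rho^{\mathcal A}_{l_1\to l_2}$ be the smallest Lipschitz constant of $F^{l_1\to l_2}_{\mathcal A}$ with respect to $|\cdot|_{\infty,l_1}$ and $|\cdot|_{l_2}$, let $\bar W=\max_{l}O_{l-1}m_l$, let $\|A^\top\|_{2,1}$ be the sum of the Euclidean norms of the rows of $A$, and fix reference matrices $M^l\in\mathbb R^{m_l\times d_l}$. **Theorem.** Let $(x_1,y_1),\dots,(x_n,y_n)$ be i.i.d. from a probability distribution on $\mathbb R^{U_0\times w_0}\times\{1,\dots,K\}$,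 and let $(x,y)$ be a fresh observation from it. For every $\delta>0$, with probability at least $1-\delta$ over the training set, the following holds simultaneously for all networks $\mathcal A$, all margins $\gamma>0$ and all real numbers $B_0,\dots,B_{L-1}\ge1$ (which may thus depend arbitrarily on the data and on $\mathcal A$), with $B_L=\gamma$: $$\mathbb P\big(\arg\max_jF_{\mathcal A}(x)_j\ne y\big)\le\frac{n-\#I}{n}+\frac8n+\frac{1536}{\sqrt n}R_{\mathcal A}\big[\log_2(32\Gamma n^2+7\bar Wn)\big]^{1/2}\log n+3\sqrt{\frac{\log(2/\delta)}{2n}}$$ $$\qquad+3\sqrt{\frac1n\sum_{l=1}^L\Big[\log\Big(2+\frac{B_{l-1}}L\Big)+\log\Big(2+\frac{\|(A^l-M^l)^\top\|_{2,1}}L\Big)+\log\Big(2+\frac{\rho^{\mathcal A}_{l+}}L\Big)\Big]}\,,$$ where ties in the argmax count as errors, $\rho^{\mathcal A}_{l+}=\max_{l\le i\le L}\rho^{\mathcal A}_{l\to i}/B_i$, $$R_{\mathcal A}^{2/3}=\sum_{l=1}^L\Big(\big(\|(A^l-M^l)^\top\|_{2,1}+\tfrac1L\big)\big(B_{l-1}+\tfrac1L\big)\big(\rho^{\mathcal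 A}_{l+}+\tfrac1L\big)\Big)^{2/3},$$ $$\Gamma=\max_{1\le l\le L}\big(B_{l-1}+\tfrac1L\big)\big(\|(A^l-M^l)^\top\|_{2,1}+\tfrac1L\big)O_{l-1}m_l\big(\rho^{\mathcal A}_{l+}+\tfrac1L\big),$$ $$I=\Big\{i\le n:\ F_{\mathcal A}(x_i)_{y_i}-\max_{j\ne y_i}F_{\mathcal A}(x_i)_j>\gamma\ \text{ and }\ |F^{0\to l}_{\mathcal A}(x_i)|_l\le B_l\ \text{ for all }0\le l\le L-1\Big\}.$$ Moreover, for the choice $B_l=\max\big(\max_{i\le n}|F^{0\to l}_{\mathcal A}(x_i)|_l,1\big)$, $l\le L-1$, one has $I=\{i\le n: F_{\mathcal A}(x_i)_{y_i}-\max_{j\ne y_i}F_{\mathcal A}(x_i)_j>\gamma\}$. -/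

import Mathlib

open scoped BigOperators

/-- A convolutional feedforward architecture of depth `L` for a classification problem.
`U l`, `w l` are the channel and spatial dimensions of the layer-`l` activations (`l ≤ L`),
`O l` is the number of convolutional patches of layer `l`, and `m (l+1)`, `d (l+1)` are the number
of filters and the patch size of the convolution from layer `l` to layer `l+1`. `patch l o` is the
ordered index set `S^{l,o}`; at `l = L` the patches only serve to define the norm `|·|_L`.
`G l` is the nonlinearity (activation and pooling) producing the layer-`(l+1)` activations.
The output layer is spatially trivial and its `U L` channels are the class scores. Everything
indexed beyond layer `L` is irrelevant. -/
structure ConvNet where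
  L : ℕ
  U : ℕ → ℕ
  w : ℕ → ℕ
  m : ℕ → ℕ
  d : ℕ → ℕ
  O : ℕ → ℕ
  patch : (l : ℕ) → Fin (O l) → (Fin (d (l + 1)) ↪ Fin (U l) × Fin (w l))
  G : (l : ℕ) → (Fin (m (l + 1)) → Fin (O l) → ℝ) →
    (Fin (U (l + 1)) → Fin (w (l + 1)) → ℝ)
  L_pos : 0 < L
  m_pos : ∀ l, l < L → 0 < m (l + 1)
  d_pos : ∀ l, l < L → 0 < d (l + 1)
  O_pos : ∀ l, l < L → 0 < O l
  w_out : w L = 1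

namespace ConvNet

/-- The layer-`l` activation space `ℝ^{U_l × w_l}`. -/
abbrev Act (net : ConvNet) (l : ℕ) := Fin (net.U l) → Fin (net.w l) → ℝ

/-- The layer-`(l+1)` preactivation space `ℝ^{m_{l+1} × O_l}`. -/
abbrev PreAct (net : ConvNet) (l : ℕ) := Fin (net.m (l + 1)) → Fin (net.O l) → ℝ

/-- The space of filter matrices `A^{l+1}` from layer `l` to layer `l+1`; rows are filters. -/
abbrev Wt (net : ConvNet) (l : ℕ) := Matrix (Fin (net.m (l + 1))) (Fin (net.d (l + 1))) ℝ

/-- The class labels `{1, …, K}`, with `K = U_L`. -/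
abbrev Label (net : ConvNet) := Fin (net.U net.L)

/-- The convolution operation `Λ_A`. -/
def conv (net : ConvNet) (l : ℕ) (A : net.Wt l) (x : net.Act l) : net.PreAct l :=
  fun j o => ∑ i, x (net.patch l o i).1 (net.patch l o i).2 * A j i

/-- One full layer: convolution followed by the nonlinearity. -/
def layer (net : ConvNet) (l : ℕ) (A : net.Wt l) (x : net.Act l) : net.Act (l + 1) :=
  net.G l (net.conv l A x)

/-- The network `F^{0→l}_𝒜`. -/
def F (net : ConvNet) (A : ∀ l, net.Wt l) : (l : ℕ) → net.Act 0 → net.Act l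
  | 0 => id
  | l + 1 => fun x => net.layer l (A l) (F net A l x)

/-- The subnetwork `F^{l₁→l₁+k}_𝒜`. -/
def sub (net : ConvNet) (A : ∀ l, net.Wt l) (l₁ : ℕ) :
    (k : ℕ) → net.Act l₁ → net.Act (l₁ + k)
  | 0 => id
  | k + 1 => fun x => net.layer (l₁ + k) (A (l₁ + k)) (sub net A l₁ k x)

/-- `|x|_l`: the maximum Euclidean norm of a convolutional patch of `x`. -/
noncomputable def patchNorm (net : ConvNet) (l : ℕ) (x : net.Act l) : ℝ :=
  ⨆ o : Fin (net.O l), Real.sqrt (∑ i, (x (net.patch l o i).1 (net.patch l o i).2) ^ 2)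

/-- `|x|_{∞,l}`: the maximum over spatial positions of the Euclidean norm across channels. -/
noncomputable def pixelNorm (net : ConvNet) (l : ℕ) (x : net.Act l) : ℝ :=
  ⨆ j : Fin (net.w l), Real.sqrt (∑ u, (x u j) ^ 2)

/-- The Euclidean norm, across the channels of a preactivation `z`, of the channelwise
`ℓ^∞` norms: `(∑_j (max_o |z_{j,o}|)²)^{1/2}`. -/
noncomputable def preNorm (net : ConvNet) (l : ℕ) (z : net.PreAct l) : ℝ :=
  Real.sqrt (∑ j, (⨆ o : Fin (net.O l), |z j o|) ^ 2)

/-- `ρ^𝒜_{l₁→l₁+k}`: the (best) Lipschitz constant of the subnetwork `F^{l₁→l₁+k}_𝒜` with respect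
to `|·|_{∞,l₁}` and `|·|_{l₁+k}`. -/
noncomputable def lipConst (net : ConvNet) (A : ∀ l, net.Wt l) (l₁ k : ℕ) : ℝ :=
  sInf {c : ℝ | 0 ≤ c ∧ ∀ x y : net.Act l₁,
    net.patchNorm (l₁ + k) (net.sub A l₁ k x - net.sub A l₁ k y) ≤
      c * net.pixelNorm l₁ (x - y)}

/-- `‖A^⊤‖_{2,1}`: the sum of the Euclidean norms of the rows of `A`. -/
noncomputable def norm21 (net : ConvNet) (l : ℕ) (A : net.Wt l) : ℝ :=
  ∑ j, Real.sqrt (∑ i, (A j i) ^ 2)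

/-- The class score `F_𝒜(x)_c`. -/
def score (net : ConvNet) (A : ∀ l, net.Wt l) (x : net.Act 0) (c : net.Label) : ℝ :=
  net.F A net.L x c ⟨0, by rw [net.w_out]; exact Nat.one_pos⟩

/-- The margin `F_𝒜(x)_y − max_{c ≠ y} F_𝒜(x)_c`. -/
noncomputable def margin (net : ConvNet) (A : ∀ l, net.Wt l) (x : net.Act 0)
    (y : net.Label) : ℝ :=
  net.score A x y - ⨆ c : {c : net.Label // c ≠ y}, net.score A x c

/-- The misclassification event `argmax_c F_𝒜(x)_c ≠ y`; ties for the maximum count as errors. -/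
def errorSet (net : ConvNet) (A : ∀ l, net.Wt l) : Set (net.Act 0 × net.Label) :=
  {p | ∃ c, c ≠ p.2 ∧ net.score A p.1 p.2 ≤ net.score A p.1 c}

/-- `W̄ = max_l O_{l-1} m_l`. -/
noncomputable def maxPreWidth (net : ConvNet) : ℝ :=
  ⨆ l : Fin net.L, (net.O l : ℝ) * (net.m ((l : ℕ) + 1) : ℝ)

/-- `ρ^𝒜_{l+} = max_{i=l}^{L} ρ^𝒜_{l→i}/B_i` (for `l ≤ L`). -/
noncomputable def rhoPlus (net : ConvNet) (A : ∀ l, net.Wt l) (B : ℕ → ℝ) (l : ℕ) : ℝ :=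
  ⨆ k : Fin (net.L - l + 1), net.lipConst A l k / B (l + (k : ℕ))

/-- `R_𝒜`, where
`R_𝒜^{2/3} = ∑_l ((‖(A^l−M^l)^⊤‖_{2,1} + 1/L)(B_{l−1} + 1/L)(ρ^𝒜_{l+} + 1/L))^{2/3}`. The summation
index `l` here is the mathematical `l − 1`. -/
noncomputable def capacity (net : ConvNet) (M A : ∀ l, net.Wt l) (B : ℕ → ℝ) : ℝ :=
  (∑ l ∈ Finset.range net.L,
    ((net.norm21 l (A l - M l) + 1 / net.L) * (B l + 1 / net.L) *
      (net.rhoPlus A B (l + 1) + 1 / net.L)) ^ ((2 : ℝ) / 3)) ^ ((3 : ℝ) / 2)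

/-- `Γ = max_l (B_{l−1} + 1/L)(‖(A^l−M^l)^⊤‖_{2,1} + 1/L) O_{l−1} m_l (ρ^𝒜_{l+} + 1/L)`. -/
noncomputable def Gam (net : ConvNet) (M A : ∀ l, net.Wt l) (B : ℕ → ℝ) : ℝ :=
  ⨆ l : Fin net.L,
    (B l + 1 / net.L) * (net.norm21 l (A l - M l) + 1 / net.L) *
      ((net.O l : ℝ) * (net.m ((l : ℕ) + 1) : ℝ)) *
      (net.rhoPlus A B ((l : ℕ) + 1) + 1 / net.L)

/-- `∑_l [log(2 + B_{l−1}/L) + log(2 + ‖(A^l−M^l)^⊤‖_{2,1}/L) + log(2 + ρ^𝒜_{l+}/L)]`. -/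
noncomputable def logSum (net : ConvNet) (M A : ∀ l, net.Wt l) (B : ℕ → ℝ) : ℝ :=
  ∑ l ∈ Finset.range net.L,
    (Real.log (2 + B l / net.L) + Real.log (2 + net.norm21 l (A l - M l) / net.L) +
      Real.log (2 + net.rhoPlus A B (l + 1) / net.L))

/-- `I`: the sample indices with margin larger than `γ` at which every input or hidden activation
satisfies `|F^{0→l}(x_i)|_l ≤ B_l` (`0 ≤ l ≤ L − 1`). -/
def goodSet (net : ConvNet) {n : ℕ} (s : Fin n → net.Act 0 × net.Label)
    (A : ∀ l, net.Wt l) (γ : ℝ) (B : ℕ → ℝ) : Set (Fin n) :=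
  {i | net.margin A (s i).1 (s i).2 > γ ∧
    ∀ l, l < net.L → net.patchNorm l (net.F A l (s i).1) ≤ B l}

/-- The choice `B_l(X) = max(max_i |F^{0→l}_𝒜(x_i)|_l, 1)` for `l < L`, and `B_L = γ`. -/
noncomputable def empiricalB (net : ConvNet) {n : ℕ} (s : Fin n → net.Act 0 × net.Label)
    (A : ∀ l, net.Wt l) (γ : ℝ) (l : ℕ) : ℝ :=
  if l < net.L then max (⨆ i : Fin n, net.patchNorm l (net.F A l (s i).1)) 1 else γ

end ConvNet

/-- The exponential moment of a sum of bounded terms with independent random signs. -/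
lemma sum_signs_exp_le (n : ℕ) (t : ℝ) (d : Fin n → ℝ) (hd : ∀ i, |d i| ≤ 1) :
    ∑ σ : Fin n → Bool, Real.exp (t * ∑ i, (if σ i then d i else - d i)) ≤
      2 ^ n * Real.exp (n * (t ^ 2 / 2)) := by
  have h1 : ∀ σ : Fin n → Bool, Real.exp (t * ∑ i, (if σ i then d i else - d i)) =
      ∏ i, Real.exp (t * (if σ i then d i else - d i)) := by
    intro σ
    rw [Finset.mul_sum, Real.exp_sum]
  simp_rw [h1]
  have h2 := (Fintype.prod_sum (fun (i : Fin n) (b : Bool) =>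
    Real.exp (t * (if b then d i else - d i)))).symm
  rw [h2]
  have h3 : ∀ i : Fin n, ∑ b : Bool, Real.exp (t * (if b then d i else - d i)) ≤
      2 * Real.exp (t ^ 2 / 2) := by
    intro i
    have hc := Real.cosh_le_exp_half_sq (t * d i)
    rw [Real.cosh_eq] at hc
    have h4 : (t * d i) ^ 2 / 2 ≤ t ^ 2 / 2 := by
      have := (sq_le_one_iff_abs_le_one (d i)).2 (hd i)
      nlinarith [sq_nonneg t]
    have h5 := Real.exp_le_exp.2 h4
    simp only [Fintype.sum_bool, if_true, Bool.false_eq_true, if_false, mul_neg]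
    linarith
  calc ∏ i, ∑ b : Bool, Real.exp (t * (if b then d i else - d i))
      ≤ ∏ _i : Fin n, 2 * Real.exp (t ^ 2 / 2) :=
        Finset.prod_le_prod (fun i _ => Finset.sum_nonneg fun b _ => (Real.exp_pos _).le)
          (fun i _ => h3 i)
    _ = _ := by
        rw [Finset.prod_const, Finset.card_univ, Fintype.card_fin, mul_pow, ← Real.exp_nat_mul]

open Classical in
/-- The indicator of a set as a real number. -/
noncomputable def indR {Z : Type*} (S : Set Z) (z : Z) : ℝ := if z ∈ S then 1 else 0

lemma indR_nonneg {Z : Type*} (S : Set Z) (z : Z) : 0 ≤ indR S z := by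
  unfold indR; split_ifs <;> norm_num

lemma indR_le_one {Z : Type*} (S : Set Z) (z : Z) : indR S z ≤ 1 := by
  unfold indR; split_ifs <;> norm_num

lemma indR_le_indR {Z : Type*} {S T : Set Z} {z : Z} (h : z ∈ S → z ∈ T) :
    indR S z ≤ indR T z := by
  unfold indR
  by_cases hS : z ∈ S
  · simp [hS, h hS]
  · simp only [hS, if_false]; split_ifs <;> norm_num

lemma measurable_indR {Z : Type*} [MeasurableSpace Z] {S : Set Z} (hS : MeasurableSet S) :
    Measurable (indR S) :=
  Measurable.ite hS measurable_const measurable_const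

open MeasureTheory

lemma integral_indR {Z : Type*} [MeasurableSpace Z] (μ : Measure Z) {S : Set Z}
    (hS : MeasurableSet S) : ∫ z, indR S z ∂μ = (μ S).toReal := by
  have : (indR S) = S.indicator (fun _ => (1 : ℝ)) := by
    funext z; unfold indR Set.indicator; rfl
  rw [this, integral_indicator hS]
  simp [Measure.real]

/-- Swapping the two halves of a double sample at the coordinates selected by `σ`. -/
def swapAt {Z : Type*} {n : ℕ} (σ : Fin n → Bool) (w : Fin n → Z × Z) : Fin n → Z × Z :=
  fun i => if σ i then w i else (w i).swap

lemma measurePreserving_swapAt {Z : Type*} [MeasurableSpace Z] (μ : Measure Z)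
    [IsProbabilityMeasure μ] {n : ℕ} (σ : Fin n → Bool) :
    MeasurePreserving (swapAt (Z := Z) σ) (Measure.pi fun _ => μ.prod μ)
      (Measure.pi fun _ => μ.prod μ) := by
  have := measurePreserving_pi (fun _ : Fin n => μ.prod μ) (fun _ : Fin n => μ.prod μ)
    (f := fun i (p : Z × Z) => if σ i then p else p.swap) (by
      intro i
      by_cases h : σ i
      · simp only [h, if_true]; exact MeasurePreserving.id _
      · simp only [h]; exact Measure.measurePreserving_swap)
  exact this

lemma lintegral_iSup_exp_le {Z : Type*} [MeasurableSpace Z] (μ : Measure Z)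
    [IsProbabilityMeasure μ] {ι : Type*} [Countable ι] (E Bd : ι → Set Z)
    (hE : ∀ k, MeasurableSet (E k)) (hB : ∀ k, MeasurableSet (Bd k)) (n N : ℕ)
    (cover : ∀ s : Fin n × Bool → Z, ∃ P : Finset (Set Z), P.card ≤ N ∧
      ∀ k, ∃ h ∈ P, ∀ i, (s i ∈ E k → s i ∈ h) ∧ (s i ∈ h → s i ∈ Bd k))
    (t : ℝ) (ht : 0 ≤ t) :
    ∫⁻ w : Fin n → Z × Z, ⨆ k, ENNReal.ofReal
        (Real.exp (t * ∑ i, (indR (E k) (w i).2 - indR (Bd k) (w i).1)))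
        ∂(Measure.pi fun _ => μ.prod μ) ≤
      ENNReal.ofReal (N * Real.exp (n * (t ^ 2 / 2))) := by
  classical
  set ν : Measure (Fin n → Z × Z) := Measure.pi fun _ => μ.prod μ with hν
  set Φ : (Fin n → Z × Z) → ENNReal := fun w => ⨆ k, ENNReal.ofReal
        (Real.exp (t * ∑ i, (indR (E k) (w i).2 - indR (Bd k) (w i).1))) with hΦ
  have hmeas : Measurable Φ := by
    refine Measurable.iSup fun k => ?_
    refine ENNReal.measurable_ofReal.comp (Real.measurable_exp.comp (Measurable.const_mul ?_ _))
    refine Finset.measurable_sum _ fun i _ => ?_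
    refine Measurable.sub ?_ ?_
    · exact (measurable_indR (hE k)).comp (measurable_snd.comp (measurable_pi_apply i))
    · exact (measurable_indR (hB k)).comp (measurable_fst.comp (measurable_pi_apply i))
  have hswap : ∀ σ : Fin n → Bool, ∫⁻ w, Φ (swapAt σ w) ∂ν = ∫⁻ w, Φ w ∂ν := fun σ =>
    (measurePreserving_swapAt μ σ).lintegral_comp hmeas
  have hpt : ∀ w, ∑ σ : Fin n → Bool, Φ (swapAt σ w) ≤
      ENNReal.ofReal (N * (2 ^ n * Real.exp (n * (t ^ 2 / 2)))) := by
    intro w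
    obtain ⟨P, hPN, hP⟩ := cover (fun q => if q.2 then (w q.1).1 else (w q.1).2)
    have hσ : ∀ σ : Fin n → Bool, Φ (swapAt σ w) ≤ ENNReal.ofReal (∑ h ∈ P,
        Real.exp (t * ∑ i, (if σ i then (indR h (w i).2 - indR h (w i).1) else
          - (indR h (w i).2 - indR h (w i).1)))) := by
      intro σ
      refine iSup_le fun k => ?_
      obtain ⟨h, hhP, hh⟩ := hP k
      refine ENNReal.ofReal_le_ofReal ?_
      refine le_trans ?_ (Finset.single_le_sum
        (f := fun h => Real.exp (t * ∑ i, (if σ i then (indR h (w i).2 - indR h (w i).1) else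
          - (indR h (w i).2 - indR h (w i).1)))) (fun _ _ => (Real.exp_pos _).le) hhP)
      refine Real.exp_le_exp.2 (mul_le_mul_of_nonneg_left (Finset.sum_le_sum fun i _ => ?_) ht)
      have h1 := hh (i, true)
      have h2 := hh (i, false)
      simp only [if_true, Bool.false_eq_true, if_false] at h1 h2
      by_cases hs : σ i
      · simp only [swapAt, hs, if_true]
        exact sub_le_sub (indR_le_indR h2.1) (indR_le_indR h1.2)
      · simp only [swapAt, hs, Bool.false_eq_true, if_false, Prod.fst_swap, Prod.snd_swap, neg_sub]
        exact sub_le_sub (indR_le_indR h1.1) (indR_le_indR h2.2)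
    calc ∑ σ : Fin n → Bool, Φ (swapAt σ w)
        ≤ ∑ σ : Fin n → Bool, ENNReal.ofReal (∑ h ∈ P,
        Real.exp (t * ∑ i, (if σ i then (indR h (w i).2 - indR h (w i).1) else
          - (indR h (w i).2 - indR h (w i).1)))) := Finset.sum_le_sum fun σ _ => hσ σ
      _ = ENNReal.ofReal (∑ σ : Fin n → Bool, ∑ h ∈ P,
        Real.exp (t * ∑ i, (if σ i then (indR h (w i).2 - indR h (w i).1) else
          - (indR h (w i).2 - indR h (w i).1)))) :=
          (ENNReal.ofReal_sum_of_nonneg fun σ _ =>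
            Finset.sum_nonneg fun _ _ => (Real.exp_pos _).le).symm
      _ ≤ _ := by
          refine ENNReal.ofReal_le_ofReal ?_
          rw [Finset.sum_comm]
          calc _ ≤ ∑ h ∈ P, 2 ^ n * Real.exp (n * (t ^ 2 / 2)) := by
                refine Finset.sum_le_sum fun h _ => sum_signs_exp_le n t _ fun i => ?_
                rw [abs_le]
                constructor <;> linarith [indR_nonneg h (w i).1, indR_nonneg h (w i).2,
                  indR_le_one h (w i).1, indR_le_one h (w i).2]
            _ = P.card * (2 ^ n * Real.exp (n * (t ^ 2 / 2))) := by simp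
            _ ≤ _ := by
                have : (P.card : ℝ) ≤ N := by exact_mod_cast hPN
                gcongr
  have hsum : (2 : ENNReal) ^ n * ∫⁻ w, Φ w ∂ν ≤
      ENNReal.ofReal (N * (2 ^ n * Real.exp (n * (t ^ 2 / 2)))) := by
    calc (2 : ENNReal) ^ n * ∫⁻ w, Φ w ∂ν = ∑ σ : Fin n → Bool, ∫⁻ w, Φ (swapAt σ w) ∂ν := by
          simp_rw [hswap]; simp
      _ = ∫⁻ w, ∑ σ : Fin n → Bool, Φ (swapAt σ w) ∂ν := by
          rw [lintegral_finsetSum]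
          exact fun σ _ => hmeas.comp (measurePreserving_swapAt μ σ).measurable
      _ ≤ ∫⁻ _, ENNReal.ofReal (N * (2 ^ n * Real.exp (n * (t ^ 2 / 2)))) ∂ν :=
          lintegral_mono hpt
      _ = _ := by simp
  have h2 : ENNReal.ofReal (N * (2 ^ n * Real.exp (n * (t ^ 2 / 2)))) =
      (2 : ENNReal) ^ n * ENNReal.ofReal (N * Real.exp (n * (t ^ 2 / 2))) := by
    rw [mul_left_comm, ENNReal.ofReal_mul (by positivity), ENNReal.ofReal_pow (by norm_num)]
    norm_num
  rw [h2] at hsum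
  exact (ENNReal.mul_le_mul_iff_right (by simp) (by simp)).1 hsum

lemma ofReal_exp_le_lintegral {Z : Type*} [MeasurableSpace Z] (μ : Measure Z)
    [IsProbabilityMeasure μ] {S : Set Z} (hS : MeasurableSet S) (n : ℕ) (t c : ℝ) :
    ENNReal.ofReal (Real.exp (t * (n * (μ S).toReal - c))) ≤
      ∫⁻ z : Fin n → Z, ENNReal.ofReal (Real.exp (t * (∑ i, indR S (z i) - c)))
        ∂(Measure.pi fun _ => μ) := by
  set ν : Measure (Fin n → Z) := Measure.pi fun _ => μ with hν
  have hm : ∀ i : Fin n, Measurable fun z : Fin n → Z => indR S (z i) := fun i =>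
    (measurable_indR hS).comp (measurable_pi_apply i)
  have hint : ∀ i : Fin n, Integrable (fun z : Fin n → Z => indR S (z i)) ν := fun i =>
    Integrable.of_bound (hm i).aestronglyMeasurable 1 (Filter.Eventually.of_forall fun z => by
      rw [Real.norm_eq_abs, abs_of_nonneg (indR_nonneg _ _)]; exact indR_le_one _ _)
  have hmean : ∀ i : Fin n, ∫ z, indR S (z i) ∂ν = (μ S).toReal := by
    intro i
    rw [← integral_indR μ hS]
    have := (measurePreserving_eval (fun _ : Fin n => μ) i)
    rw [← this.map_eq, integral_map this.measurable.aemeasurable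
      (measurable_indR hS).aestronglyMeasurable]
  set f : (Fin n → Z) → ℝ := fun z => t * (∑ i, indR S (z i) - c) with hf
  have hfm : Measurable f :=
    ((Finset.measurable_sum _ fun i _ => hm i).sub_const c).const_mul t
  have hfi : Integrable f ν :=
    ((integrable_finsetSum _ fun i _ => hint i).sub (integrable_const c)).const_mul t
  have hfmean : ∫ z, f z ∂ν = t * (n * (μ S).toReal - c) := by
    simp only [hf]
    rw [integral_const_mul, integral_sub (integrable_finsetSum _ fun i _ => hint i)
      (integrable_const c), integral_finsetSum _ fun i _ => hint i]
    simp [hmean]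
  have hbound : ∀ z, ‖Real.exp (f z)‖ ≤ Real.exp (|t| * (n + |c|)) := by
    intro z
    rw [Real.norm_eq_abs, abs_of_pos (Real.exp_pos _)]
    refine Real.exp_le_exp.2 ((le_abs_self _).trans ?_)
    rw [hf, abs_mul]
    refine mul_le_mul_of_nonneg_left ((abs_sub _ _).trans (add_le_add ?_ le_rfl)) (abs_nonneg _)
    rw [abs_of_nonneg (Finset.sum_nonneg fun i _ => indR_nonneg _ _)]
    refine (Finset.sum_le_sum fun i _ => indR_le_one S (z i)).trans ?_
    simp
  have hei : Integrable (fun z => Real.exp (f z)) ν :=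
    Integrable.of_bound (Real.measurable_exp.comp hfm).aestronglyMeasurable _
      (Filter.Eventually.of_forall hbound)
  have hJ := convexOn_exp.map_integral_le Real.continuous_exp.continuousOn isClosed_univ
    (Filter.Eventually.of_forall fun _ => Set.mem_univ _) hfi hei
  rw [hfmean] at hJ
  rw [← ofReal_integral_eq_lintegral_ofReal hei
    (Filter.Eventually.of_forall fun _ => (Real.exp_pos _).le)]
  exact ENNReal.ofReal_le_ofReal hJ

/-- A uniform one-sided deviation bound for a countable family of pairs of events which are
separated, on every double sample, by a bounded number of patterns. -/
theorem exists_event_of_pattern_cover {Z : Type*} [MeasurableSpace Z] (μ : Measure Z)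
    [IsProbabilityMeasure μ] {ι : Type*} [Countable ι] (E Bd : ι → Set Z)
    (hE : ∀ k, MeasurableSet (E k)) (hB : ∀ k, MeasurableSet (Bd k)) (n N : ℕ)
    (hn : 0 < n) (hN : 0 < N)
    (cover : ∀ s : Fin n × Bool → Z, ∃ P : Finset (Set Z), P.card ≤ N ∧
      ∀ k, ∃ h ∈ P, ∀ i, (s i ∈ E k → s i ∈ h) ∧ (s i ∈ h → s i ∈ Bd k))
    (δ : ℝ) (hδ : 0 < δ) (hδ1 : δ < 1) :
    ∃ Ev : Set (Fin n → Z), MeasurableSet Ev ∧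
      (Measure.pi fun _ : Fin n => μ) Evᶜ ≤ ENNReal.ofReal δ ∧
      ∀ s ∈ Ev, ∀ k, (μ (E k)).toReal ≤
        (∑ i, indR (Bd k) (s i)) / n + Real.sqrt (2 * Real.log (N / δ) / n) := by
  have hn' : (0 : ℝ) < n := by exact_mod_cast hn
  have hN' : (1 : ℝ) ≤ N := by exact_mod_cast hN
  have hlog : 0 < Real.log (N / δ) := Real.log_pos (by rw [lt_div_iff₀ hδ]; linarith)
  set t := Real.sqrt (2 * Real.log (N / δ) / n) with ht
  have htpos : 0 < t := Real.sqrt_pos.2 (by positivity)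
  have htsq : t ^ 2 = 2 * Real.log (N / δ) / n := Real.sq_sqrt (by positivity)
  set Ψ : (Fin n → Z) → ENNReal := fun z => ⨆ k, ENNReal.ofReal
    (Real.exp (t * (n * (μ (E k)).toReal - ∑ i, indR (Bd k) (z i)))) with hΨ
  have hmBd : ∀ k, Measurable fun z : Fin n → Z => ∑ i, indR (Bd k) (z i) := fun k =>
    Finset.measurable_sum _ fun i _ => (measurable_indR (hB k)).comp (measurable_pi_apply i)
  have hΨm : Measurable Ψ := by
    refine Measurable.iSup fun k => ?_
    exact ENNReal.measurable_ofReal.comp (Real.measurable_exp.comp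
      (((hmBd k).const_sub _).const_mul _))
  set Φ : (Fin n → Z × Z) → ENNReal := fun w => ⨆ k, ENNReal.ofReal
        (Real.exp (t * ∑ i, (indR (E k) (w i).2 - indR (Bd k) (w i).1))) with hΦ
  have hmeas : Measurable Φ := by
    refine Measurable.iSup fun k => ?_
    refine ENNReal.measurable_ofReal.comp (Real.measurable_exp.comp (Measurable.const_mul ?_ _))
    refine Finset.measurable_sum _ fun i _ => ?_
    refine Measurable.sub ?_ ?_
    · exact (measurable_indR (hE k)).comp (measurable_snd.comp (measurable_pi_apply i))
    · exact (measurable_indR (hB k)).comp (measurable_fst.comp (measurable_pi_apply i))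
  have hΨint : ∫⁻ z, Ψ z ∂(Measure.pi fun _ : Fin n => μ) ≤
      ENNReal.ofReal (N * Real.exp (n * (t ^ 2 / 2))) := by
    have hmp := (measurePreserving_arrowProdEquivProdArrow Z Z (Fin n)
      (fun _ => μ) (fun _ => μ))
    calc ∫⁻ z, Ψ z ∂(Measure.pi fun _ : Fin n => μ)
        ≤ ∫⁻ z, ∫⁻ z', Φ (fun i => (z i, z' i)) ∂(Measure.pi fun _ : Fin n => μ)
            ∂(Measure.pi fun _ : Fin n => μ) := by
          refine lintegral_mono fun z => iSup_le fun k => ?_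
          refine (ofReal_exp_le_lintegral μ (hE k) n t _).trans (lintegral_mono fun z' => ?_)
          rw [← Finset.sum_sub_distrib]
          exact le_iSup (fun k => ENNReal.ofReal (Real.exp
            (t * ∑ i, (indR (E k) (z' i) - indR (Bd k) (z i))))) k
      _ = ∫⁻ q, Φ (fun i => (q.1 i, q.2 i)) ∂((Measure.pi fun _ : Fin n => μ).prod
            (Measure.pi fun _ : Fin n => μ)) := by
          rw [lintegral_prod]
          refine Measurable.aemeasurable (hmeas.comp ?_)
          fun_prop
      _ = ∫⁻ w, Φ w ∂(Measure.pi fun _ => μ.prod μ) := by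
          exact (hmp.lintegral_comp (f := fun q : (Fin n → Z) × (Fin n → Z) =>
            Φ fun i => (q.1 i, q.2 i)) (hmeas.comp (by fun_prop))).symm
      _ ≤ _ := lintegral_iSup_exp_le μ E Bd hE hB n N cover t htpos.le
  set θ : ENNReal := ENNReal.ofReal (Real.exp (n * t ^ 2)) with hθ
  refine ⟨{z | Ψ z < θ}, measurableSet_lt hΨm measurable_const, ?_, ?_⟩
  · have hc : {z | Ψ z < θ}ᶜ = {z | θ ≤ Ψ z} := by ext z; simp
    rw [hc]
    have hM := (mul_meas_ge_le_lintegral (μ := Measure.pi fun _ : Fin n => μ) hΨm θ).trans hΨint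
    have hθ0 : θ ≠ 0 := by rw [hθ]; simp [Real.exp_pos]
    have hNδ : (N : ℝ) * Real.exp (n * (t ^ 2 / 2)) = Real.exp (n * t ^ 2) * δ := by
      have h1 : (n : ℝ) * (t ^ 2 / 2) = Real.log (N / δ) := by rw [htsq]; field_simp
      have h2 : (n : ℝ) * t ^ 2 = Real.log (N / δ) + Real.log (N / δ) := by linarith
      rw [h1, h2, Real.exp_add, Real.exp_log (by positivity)]
      field_simp
    rw [hNδ, ENNReal.ofReal_mul (Real.exp_pos _).le] at hM
    exact (ENNReal.mul_le_mul_iff_right hθ0 ENNReal.ofReal_ne_top).1 hM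
  · intro z hz k
    have h1 := lt_of_le_of_lt (le_iSup (fun k => ENNReal.ofReal
      (Real.exp (t * (n * (μ (E k)).toReal - ∑ i, indR (Bd k) (z i))))) k) hz
    rw [hθ, ENNReal.ofReal_lt_ofReal_iff (Real.exp_pos _), Real.exp_lt_exp] at h1
    have h2 : (n * (μ (E k)).toReal - ∑ i, indR (Bd k) (z i)) < n * t := by
      nlinarith
    rw [← sub_le_iff_le_add', ]
    have h3 : (μ (E k)).toReal - (∑ i, indR (Bd k) (z i)) / n =
      (n * (μ (E k)).toReal - ∑ i, indR (Bd k) (z i)) / n := by field_simp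
    rw [h3, div_le_iff₀ hn']
    linarith

lemma le_sub_of_sq_le_sq_sub {u v κ : ℝ} (hv : 0 < v)
    (h : u ^ 2 ≤ v ^ 2 - 2 * (v * κ)) : u ≤ v - κ := by
  have h1 : κ ≤ v / 2 := by
    by_contra hc
    push Not at hc
    nlinarith [sq_nonneg u]
  exact abs_le_of_sq_le_sq' (by nlinarith [sq_nonneg κ]) (by linarith) |>.2

section GreedyCover

variable {V : Type*} [NormedAddCommGroup V] [InnerProductSpace ℝ V]

/-- One row update with a quantised step length decreases the norm of the residual. -/
lemma norm_sub_smul_le {D x : V} {b e η κ : ℝ} (hb : 0 < b) (hx : ‖x‖ ≤ b)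
    (he : e = |inner ℝ D x|) (hη1 : e / (2 * b ^ 2) ≤ η) (hη2 : η ≤ e / b ^ 2)
    (hD : 0 < ‖D‖) (hκ : 4 * b ^ 2 * (‖D‖ * κ) ≤ e ^ 2) :
    ∃ s : Bool, ‖D - ((if s then η else -η) • x)‖ ≤ ‖D‖ - κ := by
  have he0 : 0 ≤ e := he ▸ abs_nonneg _
  have hη0 : 0 ≤ η := le_trans (by positivity) hη1
  refine ⟨decide (0 ≤ inner ℝ D x), ?_⟩
  refine le_sub_of_sq_le_sq_sub hD ?_
  rw [norm_sub_sq_real, inner_smul_right, norm_smul, mul_pow]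
  have h1 : (if (decide (0 ≤ inner ℝ D x)) = true then η else -η) * inner ℝ D x = η * e := by
    by_cases h : 0 ≤ inner ℝ D x
    · simp [h, he, abs_of_nonneg h]
    · simp only [h, decide_false, Bool.false_eq_true, if_false]
      rw [he, abs_of_neg (not_le.1 h)]; ring
  have h2 : ‖(if (decide (0 ≤ inner ℝ D x)) = true then η else -η)‖ ^ 2 = η ^ 2 := by
    split_ifs <;> simp
  rw [h1, h2]
  have h3 : ‖x‖ ^ 2 ≤ b ^ 2 := by gcongr
  have h4 : η * b ^ 2 ≤ e := by rwa [le_div_iff₀ (by positivity)] at hη2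
  have h5 : e ≤ η * (2 * b ^ 2) := by rwa [div_le_iff₀ (by positivity)] at hη1
  have h6 : η ^ 2 * ‖x‖ ^ 2 ≤ η * e := by
    calc η ^ 2 * ‖x‖ ^ 2 ≤ η ^ 2 * b ^ 2 := by gcongr
      _ = η * (η * b ^ 2) := by ring
      _ ≤ η * e := by gcongr
  have h7 : 2 * (‖D‖ * κ) ≤ η * e := by
    have : b ^ 2 * (2 * (‖D‖ * κ)) ≤ b ^ 2 * (η * e) := by nlinarith
    exact le_of_mul_le_mul_left this (by positivity)
  linarith

variable {J X : Type*} [Fintype J] [DecidableEq J]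

/-- The update of row `j` by a quantised multiple of the point `x i`. -/
noncomputable def greedyStep (x : X → V) (η₀ : ℝ) {g : ℕ} (D : J → V) :
    Option (J × X × Bool × Fin g) → (J → V)
  | none => D
  | some (j, i, s, k) =>
    Function.update D j (D j + (if s then ((k : ℕ) + 1) * η₀ else -(((k : ℕ) + 1) * η₀)) • x i)

/-- The matrices reachable from `0` in at most `t` greedy steps. -/
noncomputable def greedySet (J : Type*) [Fintype J] [DecidableEq J] (x : X → V) (η₀ : ℝ) (g : ℕ) :
    ℕ → Set (J → V)
  | 0 => {0}
  | t + 1 => (fun p : (J → V) × Option (J × X × Bool × Fin g) => greedyStep x η₀ p.1 p.2) ''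
      (greedySet J x η₀ g t ×ˢ Set.univ)

lemma greedySet_subset_succ (x : X → V) (η₀ : ℝ) (g t : ℕ) :
    greedySet J x η₀ g t ⊆ greedySet J x η₀ g (t + 1) := fun D hD =>
  ⟨(D, none), ⟨hD, Set.mem_univ _⟩, rfl⟩

variable [Fintype X]

lemma greedySet_finite (x : X → V) (η₀ : ℝ) (g t : ℕ) : (greedySet J x η₀ g t).Finite := by
  induction t with
  | zero => exact Set.finite_singleton _
  | succ t ih => exact (ih.prod Set.finite_univ).image _

lemma greedySet_ncard (x : X → V) (η₀ : ℝ) (g t : ℕ) :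
    (greedySet J x η₀ g t).ncard ≤
      (1 + 2 * Fintype.card J * Fintype.card X * g) ^ t := by
  induction t with
  | zero => simp [greedySet]
  | succ t ih =>
    refine (Set.ncard_image_le ((greedySet_finite x η₀ g t).prod Set.finite_univ)).trans ?_
    rw [Set.ncard_prod, Set.ncard_univ, Nat.card_eq_fintype_card, pow_succ]
    refine Nat.mul_le_mul ih (le_of_eq ?_)
    simp only [Fintype.card_option, Fintype.card_prod, Fintype.card_bool, Fintype.card_fin]
    ring

/-- If the residual is not yet small, some greedy step decreases its mixed norm. -/
lemma exists_greedyStep [Nonempty X] (x : X → V) {a b ε : ℝ} (ha : 0 < a) (hb : 0 < b)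
    (hε : 0 < ε) (hx : ∀ i, ‖x i‖ ≤ b) (g : ℕ) (hg : (a * b / ε) ^ 2 ≤ g) (D D' : J → V)
    (hD : ∑ j, ‖D j - D' j‖ ≤ a)
    (hbad : ε ^ 2 < ∑ j, (⨆ i, |inner ℝ (D j - D' j) (x i)|) ^ 2) :
    ∃ o : Option (J × X × Bool × Fin g),
      ∑ j, ‖D j - greedyStep x (ε ^ 2 / (a * b ^ 3)) D' o j‖ ≤
        ∑ j, ‖D j - D' j‖ - ε ^ 2 / (4 * a * b ^ 2) := by
  obtain ⟨j, hj⟩ : ∃ j, ε ^ 2 * ‖D j - D' j‖ / a < (⨆ i, |inner ℝ (D j - D' j) (x i)|) ^ 2 := by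
    by_contra hc
    push Not at hc
    have h1 := Finset.sum_le_sum fun j (_ : j ∈ Finset.univ) => hc j
    rw [← Finset.sum_div, ← Finset.mul_sum] at h1
    have h2 : ε ^ 2 * ∑ j, ‖D j - D' j‖ / a ≤ ε ^ 2 := by
      have : (∑ j, ‖D j - D' j‖) / a ≤ 1 := by rw [div_le_one ha]; exact hD
      rw [← Finset.sum_div]
      nlinarith [sq_nonneg ε]
    rw [← Finset.sum_div, ← mul_div_assoc] at h2
    linarith
  obtain ⟨i, hi⟩ := exists_eq_ciSup_of_finite (f := fun i => |inner ℝ (D j - D' j) (x i)|)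
  set e := |inner ℝ (D j - D' j) (x i)| with he
  rw [← hi] at hj
  change ε ^ 2 * ‖D j - D' j‖ / a < e ^ 2 at hj
  have he0 : 0 ≤ e := abs_nonneg _
  have heD : e ≤ ‖D j - D' j‖ * b :=
    (abs_real_inner_le_norm _ _).trans (mul_le_mul_of_nonneg_left (hx i) (norm_nonneg _))
  have hepos : 0 < e := by
    rcases he0.lt_or_eq with h | h
    · exact h
    · rw [← h] at hj
      have : 0 ≤ ε ^ 2 * ‖D j - D' j‖ / a := by positivity
      norm_num at hj; linarith
  have hDpos : 0 < ‖D j - D' j‖ := by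
    by_contra hc
    have : ‖D j - D' j‖ = 0 := le_antisymm (not_lt.1 hc) (norm_nonneg _)
    rw [this] at heD; linarith
  have hDa : ‖D j - D' j‖ ≤ a :=
    (Finset.single_le_sum (f := fun j => ‖D j - D' j‖) (fun _ _ => norm_nonneg _)
      (Finset.mem_univ j)).trans hD
  set η₀ := ε ^ 2 / (a * b ^ 3) with hη₀
  have hη₀pos : 0 < η₀ := by positivity
  have hj' : ε ^ 2 * ‖D j - D' j‖ < e ^ 2 * a := by rwa [div_lt_iff₀ ha] at hj
  -- the quantised step length
  have hel : ε ^ 2 < e * (a * b) := by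
    have h1 : ε ^ 2 * e < (e * (a * b)) * e := by
      calc ε ^ 2 * e ≤ ε ^ 2 * (‖D j - D' j‖ * b) := by gcongr
        _ = (ε ^ 2 * ‖D j - D' j‖) * b := by ring
        _ < (e ^ 2 * a) * b := by gcongr
        _ = _ := by ring
    exact lt_of_mul_lt_mul_right h1 he0
  set r := e / b ^ 2 / η₀ with hr
  have hre : r = e * (a * b) / ε ^ 2 := by rw [hr, hη₀]; field_simp
  have hr1 : 1 ≤ r := by rw [hre, le_div_iff₀ (by positivity), one_mul]; exact hel.le
  have hrg : r ≤ g := by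
    refine le_trans ?_ hg
    have h1 : e ≤ a * b := heD.trans (by gcongr)
    rw [hre, div_pow, sq (a * b)]
    gcongr
  have hfl1 : 1 ≤ ⌊r⌋₊ := Nat.le_floor (by simpa using hr1)
  have hflg : ⌊r⌋₊ ≤ g := Nat.floor_le_of_le hrg
  have hk : ⌊r⌋₊ - 1 < g := by omega
  have hcast : ((⌊r⌋₊ - 1 : ℕ) : ℝ) + 1 = ⌊r⌋₊ := by
    have : ⌊r⌋₊ - 1 + 1 = ⌊r⌋₊ := by omega
    exact_mod_cast this
  have hfr : (⌊r⌋₊ : ℝ) ≤ r := Nat.floor_le (by linarith)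
  have hrf : r / 2 ≤ ⌊r⌋₊ := by
    have h1 := Nat.lt_floor_add_one r
    have h2 : (1 : ℝ) ≤ ⌊r⌋₊ := by exact_mod_cast hfl1
    linarith
  have hrη : r * η₀ = e / b ^ 2 := by rw [hr]; field_simp
  obtain ⟨s, hs⟩ := norm_sub_smul_le (D := D j - D' j) (x := x i) (e := e)
    (η := ⌊r⌋₊ * η₀) (κ := ε ^ 2 / (4 * a * b ^ 2)) hb (hx i) he
    (by
      have : e / (2 * b ^ 2) = (r / 2) * η₀ := by rw [div_mul_eq_mul_div, hrη]; field_simp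
      rw [this]; gcongr)
    (by rw [← hrη]; gcongr) hDpos
    (by
      have : 4 * b ^ 2 * (‖D j - D' j‖ * (ε ^ 2 / (4 * a * b ^ 2))) =
        ε ^ 2 * ‖D j - D' j‖ / a := by field_simp
      rw [this]; exact hj.le)
  refine ⟨some (j, i, s, ⟨⌊r⌋₊ - 1, hk⟩), ?_⟩
  rw [← Finset.add_sum_erase _ _ (Finset.mem_univ j),
    ← Finset.add_sum_erase _ (fun j => ‖D j - D' j‖) (Finset.mem_univ j)]
  have hrest : ∑ j' ∈ Finset.univ.erase j, ‖D j' - greedyStep x η₀ D'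
      (some (j, i, s, (⟨⌊r⌋₊ - 1, hk⟩ : Fin g))) j'‖ =
      ∑ j' ∈ Finset.univ.erase j, ‖D j' - D' j'‖ := by
    refine Finset.sum_congr rfl fun j' hj' => ?_
    simp only [greedyStep, Function.update_of_ne (Finset.ne_of_mem_erase hj')]
  rw [hrest]
  have hrow : D j - greedyStep x η₀ D' (some (j, i, s, (⟨⌊r⌋₊ - 1, hk⟩ : Fin g))) j =
      D j - D' j - (if s then ⌊r⌋₊ * η₀ else -(⌊r⌋₊ * η₀)) • x i := by
    simp only [greedyStep, Function.update_self, hcast]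
    abel
  rw [hrow]
  linarith

/-- A finite cover, independent of the dimension, of the matrices with bounded `(2,1)` norm. -/
theorem exists_greedy_cover [Nonempty X] (x : X → V) {a b ε : ℝ} (ha : 0 < a) (hb : 0 < b)
    (hε : 0 < ε) (hx : ∀ i, ‖x i‖ ≤ b) (g : ℕ) (hg : (a * b / ε) ^ 2 ≤ g) :
    ∃ C : Finset (J → V),
      C.card ≤ (1 + 2 * Fintype.card J * Fintype.card X * g) ^ ⌊4 * (a * b / ε) ^ 2⌋₊ ∧
      ∀ D : J → V, ∑ j, ‖D j‖ ≤ a → ∃ D' ∈ C,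
        ∑ j, (⨆ i, |inner ℝ (D j - D' j) (x i)|) ^ 2 ≤ ε ^ 2 := by
  classical
  set η₀ := ε ^ 2 / (a * b ^ 3) with hη₀
  set T := ⌊4 * (a * b / ε) ^ 2⌋₊ with hT
  refine ⟨(greedySet_finite x η₀ g T).toFinset, ?_, ?_⟩
  · rw [← Set.ncard_eq_toFinset_card _ (greedySet_finite x η₀ g T)]
    exact greedySet_ncard x η₀ g T
  intro D hD
  simp only [Set.Finite.mem_toFinset]
  by_contra hc
  push Not at hc
  set κ := ε ^ 2 / (4 * a * b ^ 2) with hκ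
  have hκpos : 0 < κ := by positivity
  have key : ∀ t, t ≤ T + 1 → ∃ D' : J → V, (t ≤ T → D' ∈ greedySet J x η₀ g t) ∧
      ∑ j, ‖D j - D' j‖ ≤ a - t * κ := by
    intro t
    induction t with
    | zero => exact fun _ => ⟨0, fun _ => rfl, by simpa using hD⟩
    | succ t ih =>
      intro ht
      obtain ⟨D', hD'1, hD'2⟩ := ih (by omega)
      have hmem := hD'1 (by omega)
      have hsub : ∀ k, greedySet J x η₀ g t ⊆ greedySet J x η₀ g (t + k) := by
        intro k
        induction k with
        | zero => exact subset_rfl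
        | succ k ihk => exact ihk.trans (greedySet_subset_succ x η₀ g _)
      have hmemT : D' ∈ greedySet J x η₀ g T := by
        have := hsub (T - t) hmem
        rwa [Nat.add_sub_cancel' (by omega)] at this
      obtain ⟨o, ho⟩ := exists_greedyStep x ha hb hε hx g hg D D'
        (hD'2.trans (by have : 0 ≤ t * κ := by positivity
                        linarith)) (hc D' hmemT)
      refine ⟨greedyStep x η₀ D' o, fun _ => ⟨(D', o), ⟨hmem, Set.mem_univ _⟩, rfl⟩, ?_⟩
      push_cast
      linarith
  obtain ⟨D', -, hD'⟩ := key (T + 1) le_rfl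
  have h1 : 0 ≤ ∑ j, ‖D j - D' j‖ := Finset.sum_nonneg fun _ _ => norm_nonneg _
  have h2 : 4 * (a * b / ε) ^ 2 < T + 1 := Nat.lt_floor_add_one _
  have h3 : 4 * (a * b / ε) ^ 2 * κ = a := by rw [hκ]; field_simp
  push_cast at hD'
  nlinarith

end GreedyCover

namespace ConvNet

variable (net : ConvNet)

/-- The patch `S^{l,o}` of an activation, as a Euclidean vector. -/
noncomputable def patchVec (l : ℕ) (o : Fin (net.O l)) (x : net.Act l) :
    EuclideanSpace ℝ (Fin (net.d (l + 1))) :=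
  WithLp.toLp 2 fun i => x (net.patch l o i).1 (net.patch l o i).2

/-- A filter, as a Euclidean vector. -/
noncomputable def rowVec (l : ℕ) (A : net.Wt l) (j : Fin (net.m (l + 1))) :
    EuclideanSpace ℝ (Fin (net.d (l + 1))) :=
  WithLp.toLp 2 fun i => A j i

lemma norm_patchVec (l : ℕ) (o : Fin (net.O l)) (x : net.Act l) :
    ‖net.patchVec l o x‖ =
      Real.sqrt (∑ i, (x (net.patch l o i).1 (net.patch l o i).2) ^ 2) := by
  rw [EuclideanSpace.norm_eq]; simp [patchVec]

lemma norm_rowVec (l : ℕ) (A : net.Wt l) (j : Fin (net.m (l + 1))) :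
    ‖net.rowVec l A j‖ = Real.sqrt (∑ i, (A j i) ^ 2) := by
  rw [EuclideanSpace.norm_eq]; simp [rowVec]

lemma patchNorm_eq (l : ℕ) (x : net.Act l) :
    net.patchNorm l x = ⨆ o, ‖net.patchVec l o x‖ := by
  simp only [patchNorm, norm_patchVec]

lemma norm21_eq (l : ℕ) (A : net.Wt l) : net.norm21 l A = ∑ j, ‖net.rowVec l A j‖ := by
  simp only [norm21, norm_rowVec]

lemma conv_eq_inner (l : ℕ) (A : net.Wt l) (x : net.Act l) (j o) :
    net.conv l A x j o = inner ℝ (net.rowVec l A j) (net.patchVec l o x) := by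
  simp [conv, PiLp.inner_apply, rowVec, patchVec]

lemma patchVec_sub (l : ℕ) (o : Fin (net.O l)) (x y : net.Act l) :
    net.patchVec l o (x - y) = net.patchVec l o x - net.patchVec l o y := rfl

lemma patchNorm_nonneg (l : ℕ) (x : net.Act l) : 0 ≤ net.patchNorm l x :=
  Real.iSup_nonneg fun _ => Real.sqrt_nonneg _

lemma pixelNorm_nonneg (l : ℕ) (x : net.Act l) : 0 ≤ net.pixelNorm l x :=
  Real.iSup_nonneg fun _ => Real.sqrt_nonneg _

lemma norm21_nonneg (l : ℕ) (A : net.Wt l) : 0 ≤ net.norm21 l A :=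
  Finset.sum_nonneg fun _ _ => Real.sqrt_nonneg _

lemma norm_patchVec_le (l : ℕ) (o : Fin (net.O l)) (x : net.Act l) :
    ‖net.patchVec l o x‖ ≤ net.patchNorm l x := by
  rw [patchNorm_eq]
  exact le_ciSup (f := fun o => ‖net.patchVec l o x‖) (Set.finite_range _).bddAbove o

lemma patchNorm_le {l : ℕ} {x : net.Act l} {c : ℝ} (hc : 0 ≤ c)
    (h : ∀ o, ‖net.patchVec l o x‖ ≤ c) : net.patchNorm l x ≤ c := by
  rw [patchNorm_eq]; exact Real.iSup_le h hc

lemma abs_patch_le (l : ℕ) (x : net.Act l) (o : Fin (net.O l)) (i) :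
    |x (net.patch l o i).1 (net.patch l o i).2| ≤ net.patchNorm l x :=
  le_trans (by simpa [patchVec] using PiLp.norm_apply_le (net.patchVec l o x) i)
    (net.norm_patchVec_le l o x)

lemma abs_apply_le_pixelNorm (l : ℕ) (x : net.Act l) (u j) : |x u j| ≤ net.pixelNorm l x := by
  refine le_trans ?_ (le_ciSup (f := fun j => Real.sqrt (∑ u, (x u j) ^ 2))
    (Set.finite_range _).bddAbove j)
  exact Real.abs_le_sqrt (Finset.single_le_sum (f := fun u => (x u j) ^ 2)
    (fun _ _ => sq_nonneg _) (Finset.mem_univ u))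

lemma patchNorm_sub_le (l : ℕ) (x y z : net.Act l) :
    net.patchNorm l (x - z) ≤ net.patchNorm l (x - y) + net.patchNorm l (y - z) := by
  refine net.patchNorm_le (add_nonneg (net.patchNorm_nonneg _ _) (net.patchNorm_nonneg _ _))
    fun o => ?_
  rw [patchVec_sub]
  refine (norm_sub_le_norm_sub_add_norm_sub _ (net.patchVec l o y) _).trans ?_
  exact add_le_add (net.norm_patchVec_le l o (x - y)) (net.norm_patchVec_le l o (y - z))

lemma patchNorm_le_add_sub (l : ℕ) (x y : net.Act l) :
    net.patchNorm l y ≤ net.patchNorm l x + net.patchNorm l (x - y) := by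
  refine net.patchNorm_le (add_nonneg (net.patchNorm_nonneg _ _) (net.patchNorm_nonneg _ _))
    fun o => ?_
  have h := norm_sub_le (net.patchVec l o x) (net.patchVec l o (x - y))
  rw [patchVec_sub, sub_sub_cancel] at h
  exact h.trans (add_le_add (net.norm_patchVec_le l o x) (net.norm_patchVec_le l o (x - y)))

lemma patchNorm_sub_self (l : ℕ) (x : net.Act l) : net.patchNorm l (x - x) = 0 := by
  simp [patchNorm]

lemma patchNorm_le_pixelNorm (l : ℕ) :
    ∃ c, 0 ≤ c ∧ ∀ x : net.Act l, net.patchNorm l x ≤ c * net.pixelNorm l x := by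
  refine ⟨Real.sqrt (net.d (l + 1)), Real.sqrt_nonneg _, fun x => ?_⟩
  refine net.patchNorm_le (mul_nonneg (Real.sqrt_nonneg _) (net.pixelNorm_nonneg _ _)) fun o => ?_
  rw [norm_patchVec]
  refine Real.sqrt_le_iff.2 ⟨mul_nonneg (Real.sqrt_nonneg _) (net.pixelNorm_nonneg _ _), ?_⟩
  rw [mul_pow, Real.sq_sqrt (Nat.cast_nonneg _)]
  refine (Finset.sum_le_card_nsmul _ _ (net.pixelNorm l x ^ 2) fun i _ => ?_).trans ?_
  · rw [← sq_abs]
    exact pow_le_pow_left₀ (abs_nonneg _) (net.abs_apply_le_pixelNorm l x _ _) 2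
  · simp

lemma conv_sub_right (l : ℕ) (A : net.Wt l) (x y : net.Act l) :
    net.conv l A x - net.conv l A y = net.conv l A (x - y) := by
  funext j o
  simp only [Pi.sub_apply, conv_eq_inner, patchVec_sub, inner_sub_right]

lemma preNorm_conv_le (l : ℕ) (A : net.Wt l) (x : net.Act l) :
    net.preNorm l (net.conv l A x) ≤
      Real.sqrt (∑ j, ‖net.rowVec l A j‖ ^ 2) * net.patchNorm l x := by
  refine Real.sqrt_le_iff.2 ⟨mul_nonneg (Real.sqrt_nonneg _) (net.patchNorm_nonneg _ _), ?_⟩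
  rw [mul_pow, Real.sq_sqrt (Finset.sum_nonneg fun _ _ => sq_nonneg _), Finset.sum_mul]
  refine Finset.sum_le_sum fun j _ => ?_
  rw [← mul_pow]
  refine pow_le_pow_left₀ (Real.iSup_nonneg fun _ => abs_nonneg _) (Real.iSup_le (fun o => ?_)
    (mul_nonneg (norm_nonneg _) (net.patchNorm_nonneg _ _))) 2
  rw [conv_eq_inner]
  exact (abs_real_inner_le_norm _ _).trans
    (mul_le_mul_of_nonneg_left (net.norm_patchVec_le l o x) (norm_nonneg _))

/-- The nonlinearities are `1`-Lipschitz and do not mix channels. -/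
def LipNonlin : Prop := ∀ l, l < net.L → ∀ z z' : net.PreAct l,
  net.pixelNorm (l + 1) (net.G l z - net.G l z') ≤ net.preNorm l (z - z')

variable {net}

lemma LipNonlin.pixelNorm_layer_le (hG : net.LipNonlin) {l : ℕ} (hl : l < net.L) (A : net.Wt l)
    (x y : net.Act l) : net.pixelNorm (l + 1) (net.layer l A x - net.layer l A y) ≤
      Real.sqrt (∑ j, ‖net.rowVec l A j‖ ^ 2) * net.patchNorm l (x - y) := by
  refine (hG l hl _ _).trans ?_
  rw [conv_sub_right]
  exact net.preNorm_conv_le l A _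

lemma LipNonlin.exists_pixelNorm_sub_le (hG : net.LipNonlin) (A : ∀ l, net.Wt l) (l k : ℕ)
    (hk : l + k ≤ net.L) : ∃ c, 0 ≤ c ∧ ∀ x y : net.Act l,
      net.pixelNorm (l + k) (net.sub A l k x - net.sub A l k y) ≤ c * net.pixelNorm l (x - y) := by
  induction k with
  | zero => exact ⟨1, zero_le_one, fun x y => by simp [sub]⟩
  | succ k ih =>
    obtain ⟨c, hc, h⟩ := ih (by omega)
    obtain ⟨c', hc', h'⟩ := net.patchNorm_le_pixelNorm (l + k)
    refine ⟨Real.sqrt (∑ j, ‖net.rowVec (l + k) (A (l + k)) j‖ ^ 2) * (c' * c),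
      mul_nonneg (Real.sqrt_nonneg _) (mul_nonneg hc' hc), fun x y => ?_⟩
    refine (hG.pixelNorm_layer_le (show l + k < net.L by omega) _ _ _).trans ?_
    rw [mul_assoc]
    refine mul_le_mul_of_nonneg_left ((h' _).trans ?_) (Real.sqrt_nonneg _)
    rw [mul_assoc]
    exact mul_le_mul_of_nonneg_left (h x y) hc'

lemma lipConst_nonneg (A : ∀ l, net.Wt l) (l k : ℕ) : 0 ≤ net.lipConst A l k :=
  Real.sInf_nonneg fun _ h => h.1

lemma LipNonlin.patchNorm_sub_le (hG : net.LipNonlin) (A : ∀ l, net.Wt l) (l k : ℕ)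
    (hk : l + k ≤ net.L) (x y : net.Act l) :
    net.patchNorm (l + k) (net.sub A l k x - net.sub A l k y) ≤
      net.lipConst A l k * net.pixelNorm l (x - y) := by
  have hne : {c : ℝ | 0 ≤ c ∧ ∀ x y : net.Act l,
    net.patchNorm (l + k) (net.sub A l k x - net.sub A l k y) ≤
      c * net.pixelNorm l (x - y)}.Nonempty := by
    obtain ⟨c, hc, h⟩ := hG.exists_pixelNorm_sub_le A l k hk
    obtain ⟨c', hc', h'⟩ := net.patchNorm_le_pixelNorm (l + k)
    refine ⟨c' * c, mul_nonneg hc' hc, fun x y => (h' _).trans ?_⟩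
    rw [mul_assoc]
    exact mul_le_mul_of_nonneg_left (h x y) hc'
  rcases (net.pixelNorm_nonneg l (x - y)).lt_or_eq with hq | hq
  · rw [← div_le_iff₀ hq]
    exact le_csInf hne fun c hc => (div_le_iff₀ hq).2 (hc.2 x y)
  · obtain ⟨c, hc⟩ := hne
    have := hc.2 x y
    rw [← hq, mul_zero] at this ⊢
    exact this

/-- The identity has Lipschitz constant at least `1` as soon as the layer has a patch. -/
lemma LipNonlin.one_le_lipConst_zero (hG : net.LipNonlin) (A : ∀ l, net.Wt l) {l : ℕ}
    (hl : l ≤ net.L) (o : Fin (net.O l)) (i : Fin (net.d (l + 1))) :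
    1 ≤ net.lipConst A l 0 := by
  classical
  set p := net.patch l o i with hp
  set e : net.Act l := fun u j => if (u, j) = p then 1 else 0 with he
  have h := hG.patchNorm_sub_le A l 0 hl e 0
  have h1 : 1 ≤ net.patchNorm l e := by
    have := net.abs_patch_le l e o i
    have h2 : e (net.patch l o i).1 (net.patch l o i).2 = 1 := by simp [he, hp]
    rw [h2] at this; simpa using this
  have h2 : net.pixelNorm l e ≤ 1 := by
    refine Real.iSup_le (fun j => ?_) zero_le_one
    refine Real.sqrt_le_one.2 ?_
    by_cases hj : j = p.2
    · rw [Finset.sum_eq_single p.1]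
      · simp only [he]; split_ifs <;> norm_num
      · intro u _ hu
        have : (u, j) ≠ p := fun h => hu (by rw [← h])
        simp [he, this]
      · simp
    · refine le_of_eq_of_le (Finset.sum_eq_zero fun u _ => ?_) zero_le_one
      have : (u, j) ≠ p := fun h => hj (by rw [← h])
      simp [he, this]
  have h3 : net.patchNorm (l + 0) (net.sub A l 0 e - net.sub A l 0 0) = net.patchNorm l e := by
    simp [sub]
  rw [h3, sub_zero] at h
  have h4 := mul_le_mul_of_nonneg_left h2 (lipConst_nonneg A l 0)
  linarith

lemma F_congr {A A' : ∀ l, net.Wt l} {l : ℕ} (h : ∀ i < l, A i = A' i) (x : net.Act 0) :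
    net.F A l x = net.F A' l x := by
  induction l with
  | zero => rfl
  | succ l ih =>
    simp only [F]
    rw [ih fun i hi => h i (by omega), h l (by omega)]

/-- Two orbits of the same tail of a network stay close. -/
lemma LipNonlin.patchNorm_F_sub_le (hG : net.LipNonlin) (A A₁ A₂ : ∀ l, net.Wt l) (l k : ℕ)
    (hk : l + k ≤ net.L) (h₁ : ∀ i, l ≤ i → A₁ i = A i) (h₂ : ∀ i, l ≤ i → A₂ i = A i)
    (x : net.Act 0) :
    net.patchNorm (l + k) (net.F A₁ (l + k) x - net.F A₂ (l + k) x) ≤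
      net.lipConst A l k * net.pixelNorm l (net.F A₁ l x - net.F A₂ l x) := by
  have hsub : ∀ A' : ∀ l, net.Wt l, (∀ i, l ≤ i → A' i = A i) →
      ∀ k, net.F A' (l + k) x = net.sub A l k (net.F A' l x) := by
    intro A' h k
    induction k with
    | zero => rfl
    | succ k ih =>
      change net.layer (l + k) (A' (l + k)) (net.F A' (l + k) x) = _
      rw [ih, h (l + k) (by omega)]; rfl
  rw [hsub A₁ h₁, hsub A₂ h₂]
  exact hG.patchNorm_sub_le A l k hk _ _

/-- The network using the filters of `A'` below layer `l` and those of `A` from there on. -/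
def hybrid (A A' : ∀ l, net.Wt l) (l : ℕ) : ∀ l, net.Wt l := fun i => if i < l then A' i else A i

lemma LipNonlin.patchNorm_hybrid_le (hG : net.LipNonlin) (A A' : ∀ l, net.Wt l) (x : net.Act 0)
    {l i : ℕ} (hl : l < i) (hi : i ≤ net.L) {ε : ℝ}
    (h : net.preNorm l (net.conv l (A l) (net.F A' l x) - net.conv l (A' l) (net.F A' l x)) ≤ ε) :
    net.patchNorm i (net.F (hybrid A A' l) i x - net.F (hybrid A A' (l + 1)) i x) ≤
      net.lipConst A (l + 1) (i - (l + 1)) * ε := by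
  obtain ⟨k, rfl⟩ : ∃ k, i = l + 1 + k := ⟨i - (l + 1), by omega⟩
  rw [Nat.add_sub_cancel_left]
  refine (hG.patchNorm_F_sub_le A (hybrid A A' l) (hybrid A A' (l + 1)) (l + 1) k hi
    (fun i hi => if_neg (by omega)) (fun i hi => if_neg (by omega)) x).trans ?_
  refine mul_le_mul_of_nonneg_left ?_ (lipConst_nonneg _ _ _)
  refine le_trans ?_ h
  have e1 : net.F (hybrid A A' l) l x = net.F A' l x :=
    F_congr (fun i hi => if_pos hi) x
  have e2 : net.F (hybrid A A' (l + 1)) l x = net.F A' l x :=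
    F_congr (fun i hi => if_pos (by omega)) x
  have e3 : hybrid A A' l l = A l := if_neg (lt_irrefl l)
  have e4 : hybrid A A' (l + 1) l = A' l := if_pos (Nat.lt_succ_self l)
  simp only [F, e1, e2, e3, e4, layer]
  exact hG l (by omega) _ _

/-- The error propagated by replacing the filters of all layers. -/
lemma LipNonlin.patchNorm_F_sub_F_le (hG : net.LipNonlin) (A A' : ∀ l, net.Wt l) (x : net.Act 0)
    (ε : ℕ → ℝ) {i : ℕ} (hi : i ≤ net.L)
    (h : ∀ l < i, net.preNorm l
      (net.conv l (A l) (net.F A' l x) - net.conv l (A' l) (net.F A' l x)) ≤ ε l) :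
    net.patchNorm i (net.F A i x - net.F A' i x) ≤
      ∑ l ∈ Finset.range i, net.lipConst A (l + 1) (i - (l + 1)) * ε l := by
  have key : ∀ k ≤ i, net.patchNorm i (net.F A i x - net.F (hybrid A A' k) i x) ≤
      ∑ l ∈ Finset.range k, net.lipConst A (l + 1) (i - (l + 1)) * ε l := by
    intro k
    induction k with
    | zero =>
      intro _
      have : hybrid A A' 0 = A := by funext i; simp [hybrid]
      rw [this, patchNorm_sub_self]; simp
    | succ k ih =>
      intro hk
      rw [Finset.sum_range_succ]
      refine (net.patchNorm_sub_le i _ (net.F (hybrid A A' k) i x) _).trans ?_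
      exact add_le_add (ih (by omega)) (hG.patchNorm_hybrid_le A A' x (by omega) hi (h k (by omega)))
  have := key i le_rfl
  rwa [F_congr (A := hybrid A A' i) (A' := A') (fun j hj => if_pos hj) x] at this

/-- A finite cover of the networks with bounded filters which is accurate, layer by layer, at all
points of a finite set with bounded activations. -/
theorem exists_network_cover (net : ConvNet) {X : Type*} [Fintype X] [Nonempty X]
    (x : X → net.Act 0) (M : ∀ l, net.Wt l) (a b ε : ℕ → ℝ) (ha : ∀ l < net.L, 0 < a l)
    (hb : ∀ l < net.L, 0 < b l) (hε : ∀ l < net.L, 0 < ε l) (g : ℕ)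
    (hg : ∀ l < net.L, (a l * b l / ε l) ^ 2 ≤ g) (l : ℕ) (hl : l ≤ net.L) :
    ∃ C : Finset (∀ l, net.Wt l),
      C.card ≤ ∏ i ∈ Finset.range l,
        (1 + 2 * net.m (i + 1) * (Fintype.card X * net.O i) * g) ^
          ⌊4 * (a i * b i / ε i) ^ 2⌋₊ ∧
      ∀ A : ∀ l, net.Wt l, (∀ i < net.L, net.norm21 i (A i - M i) ≤ a i) →
        ∃ A' ∈ C, ∀ i < l, ∀ p, net.patchNorm i (net.F A' i (x p)) ≤ b i →
          net.preNorm i (net.conv i (A i) (net.F A' i (x p)) -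
            net.conv i (A' i) (net.F A' i (x p))) ≤ ε i := by
  classical
  induction l with
  | zero => exact ⟨{M}, by simp, fun A _ => ⟨M, by simp, fun i hi => absurd hi (by omega)⟩⟩
  | succ l ih =>
    obtain ⟨C, hC, hcov⟩ := ih (by omega)
    have hlL : l < net.L := hl
    have : Nonempty (Fin (net.O l)) := ⟨⟨0, net.O_pos l hlL⟩⟩
    let pt : (∀ l, net.Wt l) → X × Fin (net.O l) → EuclideanSpace ℝ (Fin (net.d (l + 1))) :=
      fun A' q => if net.patchNorm l (net.F A' l (x q.1)) ≤ b l then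
        net.patchVec l q.2 (net.F A' l (x q.1)) else 0
    have hpt : ∀ A' q, ‖pt A' q‖ ≤ b l := by
      intro A' q
      by_cases h : net.patchNorm l (net.F A' l (x q.1)) ≤ b l
      · simp only [pt, h, if_true]; exact (net.norm_patchVec_le _ _ _).trans h
      · simp only [pt, h, if_false, norm_zero]; exact (hb l hlL).le
    choose D hDcard hD using fun A' => exists_greedy_cover (J := Fin (net.m (l + 1)))
      (pt A') (ha l hlL) (hb l hlL) (hε l hlL) (hpt A') g (hg l hlL)
    let ext : (∀ l, net.Wt l) → (Fin (net.m (l + 1)) → EuclideanSpace ℝ (Fin (net.d (l + 1)))) →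
      (∀ l, net.Wt l) := fun A' E => Function.update A' l (M l + Matrix.of fun j i => E j i)
    refine ⟨C.biUnion fun A' => (D A').image (ext A'), ?_, ?_⟩
    · rw [Finset.prod_range_succ]
      refine Finset.card_biUnion_le.trans ?_
      refine (Finset.sum_le_card_nsmul _ _ _ fun A' _ =>
        Finset.card_image_le.trans (hDcard A')).trans ?_
      rw [smul_eq_mul]
      refine Nat.mul_le_mul hC (le_of_eq ?_)
      simp
    · intro A hA
      obtain ⟨A', hA'C, hA'⟩ := hcov A hA
      obtain ⟨E, hED, hE⟩ := hD A' (fun j => net.rowVec l (A l - M l) j) (by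
        rw [← norm21_eq]; exact hA l hlL)
      refine ⟨ext A' E, Finset.mem_biUnion.2 ⟨A', hA'C, Finset.mem_image_of_mem _ hED⟩, ?_⟩
      have hne : ∀ i < l, ext A' E i = A' i := fun i hi =>
        Function.update_of_ne (by omega) _ _
      have hF : ∀ i ≤ l, ∀ y, net.F (ext A' E) i y = net.F A' i y := fun i hi y =>
        F_congr (fun j hj => hne j (by omega)) y
      intro i hi p
      rcases Nat.lt_succ_iff_lt_or_eq.1 hi with hil | rfl
      · rw [hF i hil.le, hne i hil]; exact hA' i hil p
      · rw [hF i le_rfl]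
        intro hp
        have hext : ext A' E i = M i + Matrix.of fun j k => E j k := Function.update_self ..
        rw [hext]
        refine Real.sqrt_le_iff.2 ⟨(hε i hlL).le, le_trans ?_ hE⟩
        refine Finset.sum_le_sum fun j _ => ?_
        refine pow_le_pow_left₀ (Real.iSup_nonneg fun _ => abs_nonneg _) (Real.iSup_le (fun o => ?_)
          (Real.iSup_nonneg fun _ => abs_nonneg _)) 2
        refine le_of_eq_of_le ?_ (le_ciSup (f := fun q =>
          |inner ℝ (net.rowVec i (A i - M i) j - E j) (pt A' q)|)
          (Set.finite_range _).bddAbove (p, o))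
        have hrow : net.rowVec i (A i) j - net.rowVec i (M i + Matrix.of fun j k => E j k) j =
            net.rowVec i (A i - M i) j - E j := by
          ext k; simp [rowVec, sub_sub]
        simp only [pt, hp, if_true, Pi.sub_apply, conv_eq_inner, ← inner_sub_left, hrow]

end ConvNet

lemma continuous_iSup_of_finite {ι Y : Type*} [Finite ι] [TopologicalSpace Y] {f : ι → Y → ℝ}
    (hf : ∀ i, Continuous (f i)) : Continuous fun y => ⨆ i, f i y := by
  cases nonempty_fintype ι
  rcases isEmpty_or_nonempty ι with h | h
  · simp only [Real.iSup_of_isEmpty]; exact continuous_const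
  · have : (fun y => ⨆ i, f i y) = fun y => Finset.univ.sup' Finset.univ_nonempty fun i => f i y := by
      funext y; rw [Finset.sup'_univ_eq_ciSup]
    rw [this]
    exact Continuous.finset_sup'_apply _ fun i _ => hf i

namespace ConvNet

variable {net : ConvNet}

lemma continuous_preNorm (l : ℕ) : Continuous (net.preNorm l) := by
  refine Real.continuous_sqrt.comp (continuous_finsetSum _ fun j _ => Continuous.pow ?_ 2)
  exact continuous_iSup_of_finite fun o => by fun_prop

lemma continuous_patchNorm (l : ℕ) : Continuous (net.patchNorm l) :=
  continuous_iSup_of_finite fun o => by fun_prop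

lemma LipNonlin.continuous_G (hG : net.LipNonlin) {l : ℕ} (hl : l < net.L) :
    Continuous (net.G l) := by
  refine continuous_pi fun u => continuous_pi fun j => continuous_iff_continuousAt.2 fun z => ?_
  have h0 : Filter.Tendsto (fun z' => net.preNorm l (z' - z)) (nhds z) (nhds 0) := by
    have hc : Continuous fun z' => net.preNorm l (z' - z) :=
      (continuous_preNorm l).comp (continuous_id.sub continuous_const)
    have := hc.tendsto z
    simpa [preNorm] using this
  rw [ContinuousAt, tendsto_iff_dist_tendsto_zero]
  refine squeeze_zero (fun _ => dist_nonneg) (fun z' => ?_) h0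
  rw [Real.dist_eq]
  exact (net.abs_apply_le_pixelNorm (l + 1) (net.G l z' - net.G l z) u j).trans (hG l hl z' z)

lemma LipNonlin.continuous_F (hG : net.LipNonlin) {l : ℕ} (hl : l ≤ net.L) :
    Continuous fun q : (∀ l, net.Wt l) × net.Act 0 => net.F q.1 l q.2 := by
  induction l with
  | zero => exact continuous_snd
  | succ l ih =>
    have ih := ih (by omega)
    refine (hG.continuous_G (show l < net.L by omega)).comp ?_
    refine continuous_pi fun j => continuous_pi fun o => continuous_finsetSum _ fun i _ => ?_
    refine Continuous.mul ?_ ?_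
    · exact (continuous_apply (net.patch l o i).2).comp
        ((continuous_apply (net.patch l o i).1).comp ih)
    · exact ((continuous_apply l).comp continuous_fst).matrix_elem j i

lemma LipNonlin.continuous_score (hG : net.LipNonlin) (c : net.Label) :
    Continuous fun q : (∀ l, net.Wt l) × net.Act 0 => net.score q.1 q.2 c :=
  (continuous_apply _).comp ((continuous_apply c).comp (hG.continuous_F le_rfl))

lemma margin_le_sub (A : ∀ l, net.Wt l) (x : net.Act 0) {y c : net.Label} (h : c ≠ y) :
    net.margin A x y ≤ net.score A x y - net.score A x c :=
  sub_le_sub_left (le_ciSup (f := fun c : {c : net.Label // c ≠ y} => net.score A x c)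
    (Set.finite_range _).bddAbove ⟨c, h⟩) _

lemma nonempty_ne_label (hK : 2 ≤ net.U net.L) (y : net.Label) :
    Nonempty {c : net.Label // c ≠ y} := by
  have : Nontrivial net.Label := Fin.nontrivial_iff_two_le.2 hK
  obtain ⟨c, hc⟩ := exists_ne y
  exact ⟨⟨c, hc⟩⟩

lemma exists_sub_eq_margin (hK : 2 ≤ net.U net.L) (A : ∀ l, net.Wt l) (x : net.Act 0)
    (y : net.Label) : ∃ c, c ≠ y ∧ net.score A x y - net.score A x c = net.margin A x y := by
  have := nonempty_ne_label hK y
  obtain ⟨c, hc⟩ := exists_eq_ciSup_of_finite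
    (f := fun c : {c : net.Label // c ≠ y} => net.score A x c)
  exact ⟨c, c.2, by rw [margin, ← hc]⟩

/-- The event that the margin is smaller than a small multiple of `γ`. -/
def smallMargin (A : ∀ l, net.Wt l) (γ : ℝ) : Set (net.Act 0 × net.Label) :=
  {p | ∃ c, c ≠ p.2 ∧ net.score A p.1 p.2 - net.score A p.1 c < γ / 8}

/-- A neighbourhood of the event that the margin exceeds `B_L` and that all the activations are
bounded by `B`. -/
def nearlyGood (A : ∀ l, net.Wt l) (B : ℕ → ℝ) : Set (net.Act 0 × net.Label) :=
  {p | (∀ c, c ≠ p.2 → 7 / 8 * B net.L < net.score A p.1 p.2 - net.score A p.1 c) ∧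
    ∀ l, l < net.L → net.patchNorm l (net.F A l p.1) < 9 / 8 * B l}

lemma measurableSet_of_forall_label {S : net.Label → Set (net.Act 0)}
    (hS : ∀ y, MeasurableSet (S y)) : MeasurableSet {p : net.Act 0 × net.Label | p.1 ∈ S p.2} := by
  have : {p : net.Act 0 × net.Label | p.1 ∈ S p.2} = ⋃ y, S y ×ˢ {y} := by
    ext p; simp
  rw [this]
  exact MeasurableSet.iUnion fun y => (hS y).prod (measurableSet_singleton y)

lemma LipNonlin.measurable_score (hG : net.LipNonlin) (A : ∀ l, net.Wt l) (c : net.Label) :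
    Measurable fun x => net.score A x c :=
  ((hG.continuous_score c).comp (by fun_prop : Continuous fun x => (A, x))).measurable

lemma LipNonlin.measurableSet_smallMargin (hG : net.LipNonlin) (A : ∀ l, net.Wt l) (γ : ℝ) :
    MeasurableSet (smallMargin A γ) := by
  refine measurableSet_of_forall_label
    (S := fun y => {x | ∃ c, c ≠ y ∧ net.score A x y - net.score A x c < γ / 8}) fun y => ?_
  have : {x | ∃ c, c ≠ y ∧ net.score A x y - net.score A x c < γ / 8} =
      ⋃ c : {c : net.Label // c ≠ y}, {x | net.score A x y - net.score A x c < γ / 8} := by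
    ext x; simp
  rw [this]
  exact MeasurableSet.iUnion fun c => measurableSet_lt
    ((hG.measurable_score A y).sub (hG.measurable_score A c)) measurable_const

lemma LipNonlin.measurableSet_nearlyGood (hG : net.LipNonlin) (A : ∀ l, net.Wt l) (B : ℕ → ℝ) :
    MeasurableSet (nearlyGood A B) := by
  refine measurableSet_of_forall_label
    (S := fun y => {x | (∀ c, c ≠ y → 7 / 8 * B net.L < net.score A x y - net.score A x c) ∧
      ∀ l, l < net.L → net.patchNorm l (net.F A l x) < 9 / 8 * B l}) fun y => ?_
  have : {x | (∀ c, c ≠ y → 7 / 8 * B net.L < net.score A x y - net.score A x c) ∧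
      ∀ l, l < net.L → net.patchNorm l (net.F A l x) < 9 / 8 * B l} =
      (⋂ c : {c : net.Label // c ≠ y}, {x | 7 / 8 * B net.L < net.score A x y - net.score A x c}) ∩
      ⋂ l : {l // l < net.L}, {x | net.patchNorm l (net.F A l x) < 9 / 8 * B l} := by
    ext x; simp
  rw [this]
  refine (MeasurableSet.iInter fun c => ?_).inter (MeasurableSet.iInter fun l => ?_)
  · exact measurableSet_lt measurable_const
      ((hG.measurable_score A y).sub (hG.measurable_score A c))
  · refine measurableSet_lt (Continuous.measurable ?_) measurable_const
    exact (continuous_patchNorm l.1).comp ((hG.continuous_F l.2.le).comp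
      (by fun_prop : Continuous fun x => (A, x)))

/-- The networks and thresholds compatible with the a priori bounds `a`, `b`, `r`. -/
def boundedClass (M : ∀ l, net.Wt l) (a b r : ℕ → ℝ) : Set ((∀ l, net.Wt l) × (ℕ → ℝ)) :=
  {θ | (∀ l < net.L, net.norm21 l (θ.1 l - M l) ≤ a l) ∧ (∀ l < net.L, 0 < θ.2 l ∧ θ.2 l ≤ b l) ∧
    0 < θ.2 net.L ∧ ∀ l < net.L, net.rhoPlus θ.1 θ.2 (l + 1) ≤ r l}

lemma lipConst_div_le_rhoPlus (A : ∀ l, net.Wt l) (B : ℕ → ℝ) {l k : ℕ} (hk : l + k ≤ net.L) :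
    net.lipConst A l k / B (l + k) ≤ net.rhoPlus A B l :=
  le_ciSup (f := fun k : Fin (net.L - l + 1) => net.lipConst A l k / B (l + (k : ℕ)))
    (Set.finite_range _).bddAbove ⟨k, by omega⟩

/-- A covering network is close to the original one at all points where its own activations are
bounded. -/
lemma LipNonlin.patchNorm_F_sub_F_le_div (hG : net.LipNonlin) {M : ∀ l, net.Wt l}
    {a b r ε : ℕ → ℝ} (hε : ∀ l < net.L, 0 < ε l) (hr : ∀ l < net.L, 0 ≤ r l)
    (hsum : ∑ l ∈ Finset.range net.L, r l * ε l ≤ 1 / 8) {A : ∀ l, net.Wt l} {B : ℕ → ℝ}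
    (hθ : (A, B) ∈ boundedClass M a b r) (A' : ∀ l, net.Wt l) (x : net.Act 0) {i : ℕ}
    (hi : i ≤ net.L)
    (h : ∀ l < i, net.preNorm l
      (net.conv l (A l) (net.F A' l x) - net.conv l (A' l) (net.F A' l x)) ≤ ε l) :
    net.patchNorm i (net.F A i x - net.F A' i x) ≤ B i / 8 := by
  have hBi : 0 < B i := by
    rcases hi.lt_or_eq with h | h
    · exact (hθ.2.1 i h).1
    · exact h ▸ hθ.2.2.1
  refine (hG.patchNorm_F_sub_F_le A A' x ε hi h).trans ?_
  have h1 : ∀ l ∈ Finset.range i, net.lipConst A (l + 1) (i - (l + 1)) * ε l ≤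
      B i * (r l * ε l) := by
    intro l hl
    have hl' : l < i := Finset.mem_range.1 hl
    obtain ⟨k, rfl⟩ : ∃ k, i = l + 1 + k := ⟨i - (l + 1), by omega⟩
    rw [Nat.add_sub_cancel_left]
    have h2 := (lipConst_div_le_rhoPlus A B hi).trans (hθ.2.2.2 l (by omega))
    rw [div_le_iff₀ hBi] at h2
    have h3 := mul_le_mul_of_nonneg_right h2 (hε l (by omega)).le
    linarith
  refine (Finset.sum_le_sum h1).trans ?_
  rw [← Finset.mul_sum]
  have h4 : ∑ l ∈ Finset.range i, r l * ε l ≤ ∑ l ∈ Finset.range net.L, r l * ε l :=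
    Finset.sum_le_sum_of_subset_of_nonneg (Finset.range_mono hi) fun l hl _ =>
      mul_nonneg (hr l (Finset.mem_range.1 hl)) (hε l (Finset.mem_range.1 hl)).le
  nlinarith

lemma abs_score_sub_le
    (hout : ∀ p : Fin (net.U net.L) × Fin (net.w net.L), ∃ o i, net.patch net.L o i = p)
    (A A' : ∀ l, net.Wt l) (x : net.Act 0) (c : net.Label) :
    |net.score A x c - net.score A' x c| ≤
      net.patchNorm net.L (net.F A net.L x - net.F A' net.L x) := by
  obtain ⟨o, i, hoi⟩ := hout (c, ⟨0, by rw [net.w_out]; exact Nat.one_pos⟩)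
  have := net.abs_patch_le net.L (net.F A net.L x - net.F A' net.L x) o i
  rw [hoi] at this
  exact this

/-- The points at which the activations of `A'` are too large or its margin is at most `τ`. -/
def pattern (A' : ∀ l, net.Wt l) (b : ℕ → ℝ) (τ : ℝ) : Set (net.Act 0 × net.Label) :=
  {p | (∃ l < net.L, 2 * b l < net.patchNorm l (net.F A' l p.1)) ∨ net.margin A' p.1 p.2 ≤ τ}

/-- The points at which the activations of `A'` are too large. -/
def overflow (A' : ∀ l, net.Wt l) (b : ℕ → ℝ) : Set (net.Act 0 × net.Label) :=
  {p | ∃ l < net.L, 2 * b l < net.patchNorm l (net.F A' l p.1)}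

lemma LipNonlin.pattern_sandwich (hG : net.LipNonlin) (hK : 2 ≤ net.U net.L)
    (hout : ∀ p : Fin (net.U net.L) × Fin (net.w net.L), ∃ o i, net.patch net.L o i = p)
    {M : ∀ l, net.Wt l} {a b r ε : ℕ → ℝ} (hε : ∀ l < net.L, 0 < ε l) (hr : ∀ l < net.L, 0 ≤ r l)
    (hsum : ∑ l ∈ Finset.range net.L, r l * ε l ≤ 1 / 8) {A : ∀ l, net.Wt l} {B : ℕ → ℝ}
    (hθ : (A, B) ∈ boundedClass M a b r) (A' : ∀ l, net.Wt l) (p : net.Act 0 × net.Label)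
    (h : ∀ l < net.L, net.patchNorm l (net.F A' l p.1) ≤ 2 * b l → net.preNorm l
      (net.conv l (A l) (net.F A' l p.1) - net.conv l (A' l) (net.F A' l p.1)) ≤ ε l) :
    (p ∈ smallMargin A (B net.L) → p ∈ pattern A' b (B net.L / 2)) ∧
      (p ∈ pattern A' b (B net.L / 2) → p ∈ (nearlyGood A B)ᶜ) := by
  have hγ : 0 < B net.L := hθ.2.2.1
  have hclose : ∀ i ≤ net.L, (∀ l < i, net.patchNorm l (net.F A' l p.1) ≤ 2 * b l) →
      net.patchNorm i (net.F A i p.1 - net.F A' i p.1) ≤ B i / 8 := fun i hi hb =>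
    hG.patchNorm_F_sub_F_le_div hε hr hsum hθ A' p.1 hi fun l hl => h l (by omega) (hb l hl)
  constructor
  · rintro ⟨c, hc, hlt⟩
    by_contra hnot
    simp only [pattern, Set.mem_ofPred_eq, not_or, not_exists, not_and, not_lt, not_le] at hnot
    have h1 := hclose net.L le_rfl hnot.1
    have h2 := (abs_le.1 ((abs_score_sub_le hout A A' p.1 p.2).trans h1)).1
    have h3 := (abs_le.1 ((abs_score_sub_le hout A A' p.1 c).trans h1)).2
    have h4 := margin_le_sub A' p.1 hc
    linarith [hnot.2]
  · intro hp hgood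
    have hb : ∀ i ≤ net.L, ∀ l < i, net.patchNorm l (net.F A' l p.1) ≤ 2 * b l := by
      intro i
      induction i with
      | zero => intro _ l hl; omega
      | succ i ih =>
        intro hi l hl
        rcases Nat.lt_succ_iff_lt_or_eq.1 hl with hl | rfl
        · exact ih (by omega) l hl
        · have h1 := hclose l (by omega) (ih (by omega))
          have h2 := net.patchNorm_le_add_sub l (net.F A l p.1) (net.F A' l p.1)
          have h3 := hgood.2 l (by omega)
          have h4 := hθ.2.1 l (by omega)
          simp only at h4
          linarith
    have h1 := hclose net.L le_rfl (hb net.L le_rfl)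
    rcases hp with ⟨l, hl, hlt⟩ | hp
    · exact absurd (hb net.L le_rfl l hl) (not_le.2 hlt)
    · obtain ⟨c, hc, hcm⟩ := exists_sub_eq_margin hK A' p.1 p.2
      have h2 := (abs_le.1 ((abs_score_sub_le hout A A' p.1 p.2).trans h1)).2
      have h3 := (abs_le.1 ((abs_score_sub_le hout A A' p.1 c).trans h1)).1
      have h4 := hgood.1 c hc
      linarith

/-- On a finite sample, the patterns of a given network for varying threshold reduce to those for
the thresholds given by its margins. -/
lemma exists_pattern_eq {X : Type*} [Finite X] (s : X → net.Act 0 × net.Label)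
    (A' : ∀ l, net.Wt l) (b : ℕ → ℝ) (τ : ℝ) :
    ∃ o : Option X, ∀ i, s i ∈ pattern A' b τ ↔
      s i ∈ (match o with
        | none => overflow A' b
        | some j => pattern A' b (net.margin A' (s j).1 (s j).2)) := by
  by_cases hne : {i | net.margin A' (s i).1 (s i).2 ≤ τ}.Nonempty
  · obtain ⟨j, hj, hmax⟩ := Set.exists_max_image _
      (fun i => net.margin A' (s i).1 (s i).2) (Set.toFinite _) hne
    refine ⟨some j, fun i => or_congr Iff.rfl ⟨fun h => hmax i h, fun h => h.trans hj⟩⟩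
  · refine ⟨none, fun i => ⟨fun h => h.resolve_right fun h => hne ⟨i, h⟩, Or.inl⟩⟩

theorem LipNonlin.exists_pattern_cover (hG : net.LipNonlin) (hK : 2 ≤ net.U net.L)
    (hout : ∀ p : Fin (net.U net.L) × Fin (net.w net.L), ∃ o i, net.patch net.L o i = p)
    (M : ∀ l, net.Wt l) {a b r ε : ℕ → ℝ} (ha : ∀ l < net.L, 0 < a l) (hb : ∀ l < net.L, 0 < b l)
    (hε : ∀ l < net.L, 0 < ε l) (hr : ∀ l < net.L, 0 ≤ r l)
    (hsum : ∑ l ∈ Finset.range net.L, r l * ε l ≤ 1 / 8) (g : ℕ)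
    (hg : ∀ l < net.L, (a l * (2 * b l) / ε l) ^ 2 ≤ g)
    {X : Type*} [Fintype X] [Nonempty X] (s : X → net.Act 0 × net.Label) :
    ∃ P : Finset (Set (net.Act 0 × net.Label)),
      P.card ≤ (Fintype.card X + 1) * ∏ i ∈ Finset.range net.L,
        (1 + 2 * net.m (i + 1) * (Fintype.card X * net.O i) * g) ^
          ⌊4 * (a i * (2 * b i) / ε i) ^ 2⌋₊ ∧
      ∀ θ ∈ boundedClass M a b r, ∃ h ∈ P, ∀ i,
        (s i ∈ smallMargin θ.1 (θ.2 net.L) → s i ∈ h) ∧ (s i ∈ h → s i ∈ (nearlyGood θ.1 θ.2)ᶜ) := by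
  classical
  obtain ⟨C, hC, hcov⟩ := exists_network_cover net (fun i => (s i).1) M a (fun l => 2 * b l) ε ha
    (fun l hl => mul_pos two_pos (hb l hl)) hε g hg net.L le_rfl
  let f : (∀ l, net.Wt l) × Option X → Set (net.Act 0 × net.Label) := fun q => match q.2 with
    | none => overflow q.1 b
    | some j => pattern q.1 b (net.margin q.1 (s j).1 (s j).2)
  refine ⟨(C ×ˢ Finset.univ).image f, ?_, ?_⟩
  · refine Finset.card_image_le.trans ?_
    rw [Finset.card_product, Finset.card_univ, Fintype.card_option, mul_comm]
    exact Nat.mul_le_mul_left _ hC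
  · rintro ⟨A, B⟩ hθ
    obtain ⟨A', hA'C, hA'⟩ := hcov A hθ.1
    obtain ⟨o, ho⟩ := exists_pattern_eq s A' b (B net.L / 2)
    refine ⟨f (A', o), Finset.mem_image_of_mem f (Finset.mem_product.2 ⟨hA'C, Finset.mem_univ _⟩),
      fun i => ?_⟩
    have h1 := hG.pattern_sandwich hK hout hε hr hsum hθ A' (s i) fun l hl => hA' l hl i
    exact ⟨fun h => (ho i).1 (h1.1 h), fun h => h1.2 ((ho i).2 h)⟩

open MeasureTheory Filter Topology

lemma LipNonlin.eventually_smallMargin (hG : net.LipNonlin) {θ : (∀ l, net.Wt l) × (ℕ → ℝ)}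
    {u : ℕ → (∀ l, net.Wt l) × (ℕ → ℝ)} (hu : Tendsto u atTop (𝓝 θ)) (hγ : 0 < θ.2 net.L)
    {p : net.Act 0 × net.Label} (hp : p ∈ net.errorSet θ.1) :
    ∀ᶠ k in atTop, p ∈ smallMargin (u k).1 ((u k).2 net.L) := by
  obtain ⟨c, hc, hle⟩ := hp
  have hsc : ∀ c, Tendsto (fun k => net.score (u k).1 p.1 c) atTop (𝓝 (net.score θ.1 p.1 c)) :=
    fun c => (((hG.continuous_score c).comp
      (by fun_prop : Continuous fun A => (A, p.1))).tendsto θ.1).comp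
        ((continuous_fst.tendsto θ).comp hu)
  have hB : Tendsto (fun k => (u k).2 net.L / 8) atTop (𝓝 (θ.2 net.L / 8)) :=
    ((((continuous_apply net.L).comp continuous_snd).tendsto θ).comp hu).div_const 8
  have := ((hsc p.2).sub (hsc c)).eventually_lt hB (by linarith)
  filter_upwards [this] with k hk using ⟨c, hc, hk⟩

lemma LipNonlin.eventually_nearlyGood (hG : net.LipNonlin) {θ : (∀ l, net.Wt l) × (ℕ → ℝ)}
    {u : ℕ → (∀ l, net.Wt l) × (ℕ → ℝ)} (hu : Tendsto u atTop (𝓝 θ)) (hγ : 0 < θ.2 net.L)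
    (hB : ∀ l < net.L, 0 < θ.2 l) {p : net.Act 0 × net.Label}
    (hp : net.margin θ.1 p.1 p.2 > θ.2 net.L)
    (hp' : ∀ l, l < net.L → net.patchNorm l (net.F θ.1 l p.1) ≤ θ.2 l) :
    ∀ᶠ k in atTop, p ∈ nearlyGood (u k).1 (u k).2 := by
  have hu1 := (continuous_fst.tendsto θ).comp hu
  have hsc : ∀ c, Tendsto (fun k => net.score (u k).1 p.1 c) atTop (𝓝 (net.score θ.1 p.1 c)) :=
    fun c => (((hG.continuous_score c).comp
      (by fun_prop : Continuous fun A => (A, p.1))).tendsto θ.1).comp hu1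
  have hBl : ∀ l, Tendsto (fun k => (u k).2 l) atTop (𝓝 (θ.2 l)) := fun l =>
    (((continuous_apply l).comp continuous_snd).tendsto θ).comp hu
  have h1 : ∀ c, ∀ᶠ k in atTop, c ≠ p.2 →
      7 / 8 * (u k).2 net.L < net.score (u k).1 p.1 p.2 - net.score (u k).1 p.1 c := by
    intro c
    by_cases hc : c = p.2
    · exact Eventually.of_forall fun k h => absurd hc h
    · have := ((hBl net.L).const_mul (7 / 8)).eventually_lt ((hsc p.2).sub (hsc c))
        (by linarith [margin_le_sub θ.1 p.1 hc])
      filter_upwards [this] with k hk _ using hk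
  have h2 : ∀ l : Fin net.L, ∀ᶠ k in atTop,
      net.patchNorm l (net.F (u k).1 l p.1) < 9 / 8 * (u k).2 l := by
    intro l
    have hF : Tendsto (fun k => net.patchNorm l (net.F (u k).1 l p.1)) atTop
        (𝓝 (net.patchNorm l (net.F θ.1 l p.1))) :=
      (((continuous_patchNorm (net := net) l).comp ((hG.continuous_F l.2.le).comp
        (by fun_prop : Continuous fun A => (A, p.1)))).tendsto θ.1).comp hu1
    exact hF.eventually_lt ((hBl l).const_mul (9 / 8)) (by linarith [hp' l l.2, hB l l.2])
  filter_upwards [eventually_all.2 h1, eventually_all.2 h2] with k hk1 hk2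
  exact ⟨hk1, fun l hl => hk2 ⟨l, hl⟩⟩

lemma measure_le_of_eventually_mem {Z : Type*} [MeasurableSpace Z] (μ : Measure Z) {S : Set Z}
    {T : ℕ → Set Z} (h : ∀ p ∈ S, ∀ᶠ k in atTop, p ∈ T k) {c : ENNReal}
    (hc : ∀ᶠ k in atTop, μ (T k) ≤ c) : μ S ≤ c := by
  have hsub : S ⊆ ⋃ K, ⋂ k ≥ K, T k := by
    intro p hp
    obtain ⟨K, hK⟩ := eventually_atTop.1 (h p hp)
    exact Set.mem_iUnion.2 ⟨K, Set.mem_iInter₂.2 hK⟩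
  have hmono : Monotone fun K => ⋂ k ≥ K, T k := fun K K' hKK p hp =>
    Set.mem_iInter₂.2 fun k hk => Set.mem_iInter₂.1 hp k (hKK.trans hk)
  refine (measure_mono hsub).trans ?_
  rw [hmono.measure_iUnion]
  refine iSup_le fun K => ?_
  obtain ⟨K', hK'⟩ := eventually_atTop.1 hc
  exact (measure_mono (Set.iInter₂_subset (max K K') (le_max_left _ _))).trans
    (hK' _ (le_max_right _ _))

lemma sum_indR_compl_le {Z : Type*} {n : ℕ} (s : Fin n → Z) (T : Set Z) (I : Set (Fin n))
    (h : ∀ i ∈ I, s i ∈ T) : ∑ i, indR Tᶜ (s i) ≤ n - (I.ncard : ℝ) := by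
  classical
  have h1 : ∀ i, indR Tᶜ (s i) ≤ 1 - indR I i := by
    intro i
    by_cases hi : i ∈ I
    · have : indR Tᶜ (s i) = 0 := by simp [indR, h i hi]
      rw [this]; simp [indR, hi]
    · have : indR I i = 0 := by simp [indR, hi]
      rw [this, sub_zero]; exact indR_le_one _ _
  refine (Finset.sum_le_sum fun i _ => h1 i).trans (le_of_eq ?_)
  rw [Finset.sum_sub_distrib]
  have h2 : ∑ i, indR I i = (I.ncard : ℝ) := by
    simp only [indR]
    rw [Finset.sum_ite, Finset.sum_const_zero, add_zero, Finset.sum_const, nsmul_eq_mul, mul_one,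
      Set.ncard_eq_toFinset_card']
    congr 2
    ext i; simp
  rw [h2]; simp

/-- The generalisation bound for a class with a priori bounds. -/
theorem LipNonlin.exists_event_boundedClass (hG : net.LipNonlin) (hK : 2 ≤ net.U net.L)
    (hout : ∀ p : Fin (net.U net.L) × Fin (net.w net.L), ∃ o i, net.patch net.L o i = p)
    (M : ∀ l, net.Wt l) {a b r ε : ℕ → ℝ} (ha : ∀ l < net.L, 0 < a l) (hb : ∀ l < net.L, 0 < b l)
    (hε : ∀ l < net.L, 0 < ε l) (hr : ∀ l < net.L, 0 ≤ r l)
    (hsum : ∑ l ∈ Finset.range net.L, r l * ε l ≤ 1 / 8) {n : ℕ} (hn : 0 < n)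
    (hg : ∀ l < net.L, (a l * (2 * b l) / ε l) ^ 2 ≤ n)
    (μ : Measure (net.Act 0 × net.Label)) [IsProbabilityMeasure μ] (N : ℕ)
    (hN : (2 * n + 1) * ∏ i ∈ Finset.range net.L,
        (1 + 2 * net.m (i + 1) * (2 * n * net.O i) * n) ^
          ⌊4 * (a i * (2 * b i) / ε i) ^ 2⌋₊ ≤ N)
    (δ : ℝ) (hδ : 0 < δ) (hδ1 : δ < 1) :
    ∃ Ev : Set (Fin n → net.Act 0 × net.Label), MeasurableSet Ev ∧
      (Measure.pi fun _ : Fin n => μ) Evᶜ ≤ ENNReal.ofReal δ ∧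
      ∀ s ∈ Ev, ∀ θ ∈ boundedClass M a b r, (μ (net.errorSet θ.1)).toReal ≤
        ((n : ℝ) - ((net.goodSet s θ.1 (θ.2 net.L) θ.2).ncard : ℝ)) / n +
          Real.sqrt (2 * Real.log (N / δ) / n) := by
  have hn' : (0 : ℝ) < n := by exact_mod_cast hn
  have : Nonempty (Fin n) := ⟨⟨0, hn⟩⟩
  have : ∀ l, SecondCountableTopology (net.Wt l) := fun l =>
    inferInstanceAs (SecondCountableTopology (Fin (net.m (l + 1)) → Fin (net.d (l + 1)) → ℝ))
  obtain ⟨D, hDc, hDd⟩ := TopologicalSpace.exists_countable_dense (boundedClass M a b r)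
  have : Countable D := hDc
  have hNpos : 0 < N := lt_of_lt_of_le (Nat.mul_pos (by omega)
    (Finset.prod_pos fun i _ => Nat.pow_pos (by omega))) hN
  obtain ⟨Ev, hEvm, hEvμ, hEv⟩ := exists_event_of_pattern_cover μ
    (fun θ : D => smallMargin θ.1.1.1 (θ.1.1.2 net.L)) (fun θ : D => (nearlyGood θ.1.1.1 θ.1.1.2)ᶜ)
    (fun θ => hG.measurableSet_smallMargin _ _)
    (fun θ => (hG.measurableSet_nearlyGood _ _).compl) n N hn hNpos (fun s => by
      obtain ⟨P, hPc, hP⟩ := hG.exists_pattern_cover hK hout M ha hb hε hr hsum n hg s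
      refine ⟨P, hPc.trans (le_of_eq_of_le ?_ hN), fun θ => hP θ.1.1 θ.1.2⟩
      simp [mul_comm n 2]) δ hδ hδ1
  refine ⟨Ev, hEvm, hEvμ, fun s hs θ hθ => ?_⟩
  obtain ⟨u, huD, hu⟩ := mem_closure_iff_seq_limit.1 (hDd ⟨θ, hθ⟩)
  have hu' : Tendsto (fun k => (u k).1) atTop (𝓝 θ) :=
    (continuous_subtype_val.tendsto _).comp hu
  set c := ((n : ℝ) - ((net.goodSet s θ.1 (θ.2 net.L) θ.2).ncard : ℝ)) / n +
          Real.sqrt (2 * Real.log (N / δ) / n) with hc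
  have hgood : ∀ᶠ k in atTop, ∀ i, i ∈ net.goodSet s θ.1 (θ.2 net.L) θ.2 →
      s i ∈ nearlyGood (u k).1.1 (u k).1.2 := by
    refine eventually_all.2 fun i => ?_
    by_cases hi : i ∈ net.goodSet s θ.1 (θ.2 net.L) θ.2
    · filter_upwards [hG.eventually_nearlyGood hu' hθ.2.2.1 (fun l hl => (hθ.2.1 l hl).1)
        hi.1 hi.2] with k hk _ using hk
    · exact Eventually.of_forall fun k h => absurd h hi
  have hbound : ∀ᶠ k in atTop,
      μ (smallMargin (u k).1.1 ((u k).1.2 net.L)) ≤ ENNReal.ofReal c := by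
    filter_upwards [hgood] with k hk
    rw [← ENNReal.ofReal_toReal (measure_ne_top μ _)]
    refine ENNReal.ofReal_le_ofReal ((hEv s hs ⟨u k, huD k⟩).trans ?_)
    rw [hc]
    gcongr
    exact sum_indR_compl_le s _ _ hk
  have hμ := measure_le_of_eventually_mem μ
    (fun p hp => hG.eventually_smallMargin hu' hθ.2.2.1 hp) hbound
  have hc0 : 0 ≤ c := by
    refine add_nonneg (div_nonneg (sub_nonneg.2 ?_) hn'.le) (Real.sqrt_nonneg _)
    have := Set.ncard_le_ncard (Set.subset_univ (net.goodSet s θ.1 (θ.2 net.L) θ.2))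
    rw [Set.ncard_univ, Nat.card_eq_fintype_card, Fintype.card_fin] at this
    exact_mod_cast this
  exact ENNReal.toReal_le_of_le_ofReal hc0 hμ

end ConvNet

namespace ConvNet

variable {net : ConvNet}

lemma mul_le_maxPreWidth {l : ℕ} (hl : l < net.L) :
    (net.O l : ℝ) * (net.m (l + 1) : ℝ) ≤ net.maxPreWidth :=
  le_ciSup (f := fun l : Fin net.L => (net.O l : ℝ) * (net.m ((l : ℕ) + 1) : ℝ))
    (Set.finite_range _).bddAbove ⟨l, hl⟩

lemma one_le_maxPreWidth : 1 ≤ net.maxPreWidth := by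
  refine le_trans ?_ (mul_le_maxPreWidth (net := net) net.L_pos)
  have h1 : 1 ≤ net.O 0 * net.m (0 + 1) :=
    Nat.mul_pos (net.O_pos 0 net.L_pos) (net.m_pos 0 net.L_pos)
  exact_mod_cast h1

open MeasureTheory

/-- The generalisation bound for a class with a priori bounds, with the optimal allocation of the
approximation errors to the layers. -/
theorem LipNonlin.exists_event_of_capacity (hG : net.LipNonlin) (hK : 2 ≤ net.U net.L)
    (hout : ∀ p : Fin (net.U net.L) × Fin (net.w net.L), ∃ o i, net.patch net.L o i = p)
    (M : ∀ l, net.Wt l) {a b r : ℕ → ℝ} (ha : ∀ l < net.L, 0 < a l) (hb : ∀ l < net.L, 0 < b l)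
    (hr : ∀ l < net.L, 0 < r l) {n : ℕ} (hn : 0 < n) {S : ℝ}
    (hS : S = ∑ l ∈ Finset.range net.L, (a l * b l * r l) ^ ((2 : ℝ) / 3))
    (hSn : 256 * S ^ 3 ≤ n)
    (μ : Measure (net.Act 0 × net.Label)) [IsProbabilityMeasure μ]
    (δ : ℝ) (hδ : 0 < δ) (hδ1 : δ < 1) :
    ∃ Ev : Set (Fin n → net.Act 0 × net.Label), MeasurableSet Ev ∧
      (Measure.pi fun _ : Fin n => μ) Evᶜ ≤ ENNReal.ofReal δ ∧
      ∀ s ∈ Ev, ∀ θ ∈ boundedClass M a b r, (μ (net.errorSet θ.1)).toReal ≤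
        ((n : ℝ) - ((net.goodSet s θ.1 (θ.2 net.L) θ.2).ncard : ℝ)) / n +
          Real.sqrt (2 * (Real.log (2 * n + 1) +
            1024 * S ^ 3 * Real.log (1 + 4 * n ^ 2 * net.maxPreWidth) + Real.log (1 / δ)) / n) := by
  have hn' : (0 : ℝ) < n := by exact_mod_cast hn
  set τ : ℕ → ℝ := fun l => (a l * b l * r l) ^ ((1 : ℝ) / 3) with hτ
  have hTpos : ∀ l < net.L, 0 < a l * b l * r l := fun l hl =>
    mul_pos (mul_pos (ha l hl) (hb l hl)) (hr l hl)
  have hτpos : ∀ l < net.L, 0 < τ l := fun l hl => Real.rpow_pos_of_pos (hTpos l hl) _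
  have hτ3 : ∀ l < net.L, τ l ^ 3 = a l * b l * r l := fun l hl => by
    rw [hτ, ← Real.rpow_natCast, ← Real.rpow_mul (hTpos l hl).le]; norm_num
  have hτ2 : ∀ l < net.L, (a l * b l * r l) ^ ((2 : ℝ) / 3) = τ l ^ 2 := fun l hl => by
    rw [hτ, ← Real.rpow_natCast, ← Real.rpow_mul (hTpos l hl).le]; norm_num
  have hSτ : S = ∑ l ∈ Finset.range net.L, τ l ^ 2 := by
    rw [hS]; exact Finset.sum_congr rfl fun l hl => hτ2 l (Finset.mem_range.1 hl)
  have hτS : ∀ l < net.L, τ l ^ 2 ≤ S := fun l hl => by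
    rw [hSτ]
    exact Finset.single_le_sum (f := fun l => τ l ^ 2) (fun _ _ => sq_nonneg _)
      (Finset.mem_range.2 hl)
  have hSpos : 0 < S := lt_of_lt_of_le (pow_pos (hτpos 0 net.L_pos) 2) (hτS 0 net.L_pos)
  set ε : ℕ → ℝ := fun l => τ l ^ 2 / (8 * r l * S) with hε
  have hεpos : ∀ l < net.L, 0 < ε l := fun l hl => by
    have := hτpos l hl; have := hr l hl
    positivity
  have hq : ∀ l < net.L, (a l * (2 * b l) / ε l) ^ 2 = 256 * (τ l ^ 2 * S ^ 2) := fun l hl => by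
    have h1 := hτpos l hl; have h2 := hr l hl
    have h3 : a l * (2 * b l) / ε l = 16 * τ l * S := by
      rw [hε, div_eq_iff (hεpos l hl).ne']
      have : a l * b l = τ l ^ 3 / r l := by rw [hτ3 l hl]; field_simp
      calc a l * (2 * b l) = 2 * (a l * b l) := by ring
        _ = _ := by rw [this]; simp only [hε]; field_simp; norm_num
    rw [h3]; ring
  have hsum : ∑ l ∈ Finset.range net.L, r l * ε l ≤ 1 / 8 := by
    have : ∀ l ∈ Finset.range net.L, r l * ε l = τ l ^ 2 / (8 * S) := fun l hl => by
      have := hr l (Finset.mem_range.1 hl)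
      simp only [hε]; field_simp
    rw [Finset.sum_congr rfl this, ← Finset.sum_div, ← hSτ]
    apply le_of_eq; field_simp
  set N : ℕ := (2 * n + 1) * ∏ i ∈ Finset.range net.L,
        (1 + 2 * net.m (i + 1) * (2 * n * net.O i) * n) ^
          ⌊4 * (a i * (2 * b i) / ε i) ^ 2⌋₊ with hN
  obtain ⟨Ev, h1, h2, h3⟩ := hG.exists_event_boundedClass hK hout M ha hb hεpos
    (fun l hl => (hr l hl).le) hsum hn (fun l hl => by
      rw [hq l hl]
      have := hτS l hl
      have : τ l ^ 2 * S ^ 2 ≤ S ^ 3 := by nlinarith [pow_pos hSpos 2]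
      linarith) μ N le_rfl δ hδ hδ1
  refine ⟨Ev, h1, h2, fun s hs θ hθ => (h3 s hs θ hθ).trans ?_⟩
  gcongr
  have hfac : ∀ i, (0 : ℝ) < 1 + 2 * net.m (i + 1) * (2 * n * net.O i) * n := fun i => by
    positivity
  have hNlog : Real.log N = Real.log (2 * n + 1) + ∑ i ∈ Finset.range net.L,
      (⌊4 * (a i * (2 * b i) / ε i) ^ 2⌋₊ : ℝ) *
        Real.log (1 + 2 * net.m (i + 1) * (2 * n * net.O i) * n) := by
    rw [hN]
    push_cast
    rw [Real.log_mul (by positivity) (Finset.prod_ne_zero_iff.2 fun i _ => by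
      have := hfac i; positivity), Real.log_prod fun i _ => by
      have := hfac i; positivity]
    simp_rw [Real.log_pow]
  have hNpos : (0 : ℝ) < N := by
    rw [hN]; push_cast
    exact mul_pos (by positivity) (Finset.prod_pos fun i _ => pow_pos (hfac i) _)
  rw [Real.log_div hNpos.ne' hδ.ne', one_div, Real.log_inv, hNlog]
  have hmain : ∑ i ∈ Finset.range net.L, (⌊4 * (a i * (2 * b i) / ε i) ^ 2⌋₊ : ℝ) *
        Real.log (1 + 2 * net.m (i + 1) * (2 * n * net.O i) * n) ≤
      ∑ i ∈ Finset.range net.L, (1024 * (τ i ^ 2 * S ^ 2)) *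
        Real.log (1 + 4 * n ^ 2 * net.maxPreWidth) := by
    refine Finset.sum_le_sum fun i hi => ?_
    have hi' := Finset.mem_range.1 hi
    refine mul_le_mul ?_ (Real.log_le_log (hfac i) ?_) (Real.log_nonneg ?_) (by positivity)
    · rw [hq i hi']
      refine (Nat.floor_le (by positivity)).trans (le_of_eq (by ring))
    · have := mul_le_maxPreWidth hi'
      have h4 : (2 : ℝ) * net.m (i + 1) * (2 * n * net.O i) * n =
        4 * n ^ 2 * (net.O i * net.m (i + 1)) := by ring
      rw [h4]; gcongr
    · have : (0 : ℝ) ≤ 2 * net.m (i + 1) * (2 * n * net.O i) * n := by positivity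
      linarith
  rw [← Finset.sum_mul, ← Finset.mul_sum, ← Finset.sum_mul, ← hSτ] at hmain
  have : 1024 * (S * S ^ 2) = 1024 * S ^ 3 := by ring
  rw [this] at hmain
  linarith

end ConvNet

/-- Points of a dyadic grid approximate every moderate number from above. -/
lemma exists_dyadic_near {L n : ℕ} (hL : 0 < L) {x : ℝ} (hx : 1 ≤ L * x)
    (hxn : 2 * (L * x) ≤ (n : ℝ) ^ 4) :
    ∃ k : Fin (Nat.log 2 (n ^ 4) + 1), x ≤ 2 ^ (k : ℕ) / L ∧ (2 : ℝ) ^ (k : ℕ) / L ≤ 2 * x := by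
  have hL' : (0 : ℝ) < L := by exact_mod_cast hL
  obtain ⟨k, hk1, hk2⟩ := exists_nat_pow_near hx (one_lt_two (α := ℝ))
  have hk3 : (2 : ℝ) ^ (k + 1) ≤ 2 * (L * x) := by rw [pow_succ]; linarith
  have hk4 : 2 ^ (k + 1) ≤ n ^ 4 := by exact_mod_cast hk3.trans hxn
  refine ⟨⟨k + 1, Nat.lt_succ_of_le (Nat.le_log_of_pow_le one_lt_two hk4)⟩, ?_, ?_⟩
  · rw [le_div_iff₀ hL']; linarith
  · rw [div_le_iff₀ hL']; linarith

lemma two_le_log_of_nine_le {n : ℕ} (hn : 9 ≤ n) : 2 ≤ Real.log n := by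
  have hn' : (9 : ℝ) ≤ n := by exact_mod_cast hn
  rw [Real.le_log_iff_exp_le (by linarith)]
  have : Real.exp 2 = Real.exp 1 ^ 2 := by rw [← Real.exp_nat_mul]; norm_num
  rw [this]; nlinarith [Real.exp_one_lt_d9, Real.exp_pos 1]

lemma natLog_add_one_le {n : ℕ} (hn : 9 ≤ n) :
    ((Nat.log 2 (n ^ 4) + 1 : ℕ) : ℝ) ≤ 7 * Real.log n := by
  have hn' : (9 : ℝ) ≤ n := by exact_mod_cast hn
  have hl2 := Real.log_two_gt_d9
  have hℓ := two_le_log_of_nine_le hn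
  have h1 : (2 : ℝ) ^ Nat.log 2 (n ^ 4) ≤ (n : ℝ) ^ 4 := by
    exact_mod_cast Nat.pow_log_le_self 2 (by positivity)
  have h2 := Real.log_le_log (by positivity) h1
  rw [Real.log_pow, Real.log_pow] at h2
  push_cast at h2 ⊢
  nlinarith [(Nat.cast_nonneg (Nat.log 2 (n ^ 4)) : (0 : ℝ) ≤ _)]

/-- The layerwise lower bound on the capacity coming from the telescoping ratios of the
activation bounds. -/
lemma log_ratio_sum_le {L : ℕ} (hL : 2 ≤ L) {T B : ℕ → ℝ} (hT : ∀ l < L, 0 < T l)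
    (hB : ∀ l < L, 1 ≤ B l) (hTB : ∀ l, l + 1 < L → B l / B (l + 1) ≤ L * T l) {ℓ : ℝ}
    (hℓ : 1 ≤ ℓ) :
    6 * L * Real.log ℓ ≤ 10 ^ 6 * (∑ l ∈ Finset.range L, T l ^ ((2 : ℝ) / 3)) ^ 3 * ℓ ^ 3 +
      8 * Real.log (2 + B (L - 1) / L) := by
  have hL0 : (0 : ℝ) < L := by exact_mod_cast (by omega : 0 < L)
  have hL2 : (2 : ℝ) ≤ L := by exact_mod_cast hL
  have hℓ0 : 0 < ℓ := by linarith
  have hlogℓ : 0 ≤ Real.log ℓ := Real.log_nonneg hℓ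
  set z : ℕ → ℝ := fun l => (L * T l) ^ ((2 : ℝ) / 3) with hz
  set Z := ∑ l ∈ Finset.range L, z l with hZ
  set S := ∑ l ∈ Finset.range L, T l ^ ((2 : ℝ) / 3) with hS
  have hzpos : ∀ l < L, 0 < z l := fun l hl => Real.rpow_pos_of_pos (mul_pos hL0 (hT l hl)) _
  have hZS : Z = (L : ℝ) ^ ((2 : ℝ) / 3) * S := by
    rw [hZ, hS, Finset.mul_sum]
    exact Finset.sum_congr rfl fun l hl =>
      Real.mul_rpow hL0.le (hT l (Finset.mem_range.1 hl)).le
  have hZ3 : Z ^ 3 = (L : ℝ) ^ 2 * S ^ 3 := by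
    rw [hZS, mul_pow]
    congr 1
    rw [← Real.rpow_natCast, ← Real.rpow_mul hL0.le]
    norm_num
  have hZ0 : 0 ≤ Z := Finset.sum_nonneg fun l hl => (hzpos l (Finset.mem_range.1 hl)).le
  -- each layer contributes its logarithmic ratio
  have hlayer : ∀ l ∈ Finset.range (L - 1), 1 + Real.log ℓ +
      (2 / 3 * Real.log (B l) - 2 / 3 * Real.log (B (l + 1))) ≤ ℓ * z l := by
    intro l hl
    have hl' : l + 1 < L := by have := Finset.mem_range.1 hl; omega
    have hBl := hB l (by omega)
    have hBl1 := hB (l + 1) hl'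
    have hzl := hzpos l (by omega)
    have h1 := Real.log_le_sub_one_of_pos (mul_pos hℓ0 hzl)
    rw [Real.log_mul hℓ0.ne' hzl.ne', hz, Real.log_rpow (mul_pos hL0 (hT l (by omega)))] at h1
    have h2 := Real.log_le_log (by positivity) (hTB l hl')
    rw [Real.log_div (by positivity) (by positivity)] at h2
    simp only [hz]
    linarith
  have hY : (L - 1) * (1 + Real.log ℓ) - 2 / 3 * Real.log (B (L - 1)) ≤ ℓ * Z := by
    have h1 := Finset.sum_le_sum hlayer
    rw [Finset.sum_add_distrib, Finset.sum_range_sub' (fun l => 2 / 3 * Real.log (B l)),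
      Finset.sum_const, Finset.card_range, nsmul_eq_mul, Nat.cast_sub (by omega)] at h1
    have h2 : ∑ l ∈ Finset.range (L - 1), ℓ * z l ≤ ∑ l ∈ Finset.range L, ℓ * z l :=
      Finset.sum_le_sum_of_subset_of_nonneg (Finset.range_mono (by omega)) fun l hl _ =>
        mul_nonneg hℓ0.le (hzpos l (Finset.mem_range.1 hl)).le
    rw [← Finset.mul_sum (Finset.range L)] at h2
    have h3 : 0 ≤ Real.log (B 0) := Real.log_nonneg (hB 0 (by omega))
    push_cast at h1
    linarith
  have hcube : 12 * (ℓ * Z) - 2 * L ≤ 10 ^ 6 * S ^ 3 * ℓ ^ 3 := by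
    set y := ℓ * Z / L with hy
    have hy0 : 0 ≤ y := by positivity
    have h1 : ℓ * Z = L * y := by rw [hy]; field_simp
    have h2 : S ^ 3 * ℓ ^ 3 = L * y ^ 3 := by
      have : (L : ℝ) ^ 2 * (S ^ 3 * ℓ ^ 3) = L ^ 2 * (L * y ^ 3) := by
        rw [← mul_assoc, ← hZ3, ← mul_pow, mul_comm Z, h1]; ring
      exact mul_left_cancel₀ (by positivity) this
    have h3 : 12 * y - 2 ≤ 10 ^ 6 * y ^ 3 := by
      nlinarith [mul_nonneg hy0 (sq_nonneg (4 * y - 1)), sq_nonneg (4 * y - 1), pow_nonneg hy0 3]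
    rw [h1, mul_assoc, h2]
    nlinarith
  have hBL := hB (L - 1) (by omega)
  have hlogB : Real.log (B (L - 1)) ≤ L / 2 + Real.log (2 + B (L - 1) / L) := by
    have h1 : Real.log (B (L - 1)) ≤ Real.log (L * (2 + B (L - 1) / L)) := by
      refine Real.log_le_log (by linarith) ?_
      rw [mul_add, mul_div_cancel₀ _ hL0.ne']; linarith
    rw [Real.log_mul hL0.ne' (by positivity)] at h1
    have h2 := Real.log_le_sub_one_of_pos (show (0 : ℝ) < L / 2 by positivity)
    rw [Real.log_div hL0.ne' two_ne_zero] at h2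
    have := Real.log_two_lt_d9
    linarith
  nlinarith

/-- The complexity terms dominate the cost of the union bound and of the covering numbers. -/
lemma union_cost_le {L n : ℕ} (hL : 0 < L) (hn : 9 ≤ n) {T B : ℕ → ℝ} {S Λ : ℝ}
    (hS : S = ∑ l ∈ Finset.range L, T l ^ ((2 : ℝ) / 3))
    (hT : ∀ l < L, 1 / (L : ℝ) ^ 2 ≤ T l)
    (hB : ∀ l < L, 1 ≤ B l) (hTB : ∀ l, l + 1 < L → B l / B (l + 1) ≤ L * T l)
    (hΛ : Real.log (2 + B (L - 1) / L) + (3 * L - 1) * Real.log 2 ≤ Λ) :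
    2 * Real.log (2 * n + 1) + 6 * L * Real.log ((Nat.log 2 (n ^ 4) + 1 : ℕ) : ℝ) ≤
      2 * 10 ^ 6 * S ^ 3 * Real.log n ^ 3 + 9 * Λ := by
  have hL0 : (0 : ℝ) < L := by exact_mod_cast hL
  have hL1 : (1 : ℝ) ≤ L := by exact_mod_cast hL
  have hn' : (9 : ℝ) ≤ n := by exact_mod_cast hn
  set ℓ := Real.log n with hℓ
  have hℓ2 : 2 ≤ ℓ := two_le_log_of_nine_le hn
  have hT0 : ∀ l < L, 0 < T l := fun l hl => lt_of_lt_of_le (by positivity) (hT l hl)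
  have h2 := Real.log_two_gt_d9
  have hBL := hB (L - 1) (by omega)
  have hlog1 : Real.log (2 * n + 1) ≤ 2 * ℓ := by
    have : Real.log ((n : ℝ) ^ 2) = 2 * ℓ := by rw [Real.log_pow]; norm_num [hℓ]
    rw [← this]
    exact Real.log_le_log (by positivity) (by nlinarith)
  have hlogH : Real.log ((Nat.log 2 (n ^ 4) + 1 : ℕ) : ℝ) ≤ 2 + Real.log ℓ := by
    refine (Real.log_le_log (by positivity) (natLog_add_one_le hn)).trans ?_
    rw [Real.log_mul (by norm_num) (by positivity)]
    have : Real.log 7 ≤ 2 := by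
      rw [Real.log_le_iff_le_exp (by norm_num)]
      have : Real.exp 2 = Real.exp 1 ^ 2 := by rw [← Real.exp_nat_mul]; norm_num
      rw [this]; nlinarith [Real.exp_one_gt_d9]
    linarith
  have hS3 : 1 / L ≤ S ^ 3 := by
    have h1 : (L : ℝ) * (1 / (L : ℝ) ^ 2) ^ ((2 : ℝ) / 3) ≤ S := by
      rw [hS]
      refine le_of_eq_of_le ?_ (Finset.sum_le_sum fun l hl => Real.rpow_le_rpow
        (by positivity) (hT l (Finset.mem_range.1 hl)) (by norm_num))
      simp
    have h3 : ((L : ℝ) * (1 / (L : ℝ) ^ 2) ^ ((2 : ℝ) / 3)) ^ 3 = 1 / L := by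
      rw [mul_pow, ← Real.rpow_natCast (_ ^ ((2 : ℝ) / 3)), ← Real.rpow_mul (by positivity)]
      norm_num
      field_simp
    rw [← h3]
    exact pow_le_pow_left₀ (by positivity) h1 3
  have hlogℓ : Real.log ℓ ≤ ℓ := (Real.log_le_sub_one_of_pos (by linarith)).trans (by linarith)
  have hlogB0 : 0 ≤ Real.log (2 + B (L - 1) / L) := Real.log_nonneg (by
    have : 0 ≤ B (L - 1) / L := by positivity
    linarith)
  have hcost : 2 * Real.log (2 * n + 1) + 6 * L * Real.log ((Nat.log 2 (n ^ 4) + 1 : ℕ) : ℝ) ≤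
      4 * ℓ + 12 * L + 6 * L * Real.log ℓ := by nlinarith
  refine hcost.trans ?_
  have hpay : 4 * ℓ ≤ 10 ^ 6 * S ^ 3 * ℓ ^ 3 + L := by
    have h4 : 10 ^ 6 * (1 / L) * ℓ ^ 2 ≤ 10 ^ 6 * S ^ 3 * ℓ ^ 3 := by
      have : ℓ ^ 2 ≤ ℓ ^ 3 := pow_le_pow_right₀ (by linarith) (by norm_num)
      have hS0 : 0 ≤ S ^ 3 := le_trans (by positivity) hS3
      gcongr
    have h5 : 4 * ℓ ≤ 10 ^ 6 * (1 / L) * ℓ ^ 2 + L := by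
      have h6 : 0 ≤ (1000 * ℓ - L) ^ 2 / L := by positivity
      have h7 : (1000 * ℓ - L) ^ 2 / L = 10 ^ 6 * (1 / L) * ℓ ^ 2 - 2000 * ℓ + L := by
        field_simp; ring
      linarith
    linarith
  have hΛ0 : 0 ≤ Λ := by nlinarith
  rcases Nat.lt_or_ge 1 L with hL2 | hL2
  · have h3 := log_ratio_sum_le hL2 hT0 hB hTB (show 1 ≤ ℓ by linarith)
    rw [← hS] at h3
    have hL2' : (2 : ℝ) ≤ L := by exact_mod_cast hL2
    nlinarith
  · have hL1' : L = 1 := by omega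
    subst hL1'
    norm_num at hS3 hΛ hpay ⊢
    have h4 : ℓ ^ 3 ≤ S ^ 3 * ℓ ^ 3 := le_mul_of_one_le_left (by positivity) hS3
    have h5 : 4 * ℓ ≤ ℓ ^ 3 := by
      nlinarith [mul_nonneg (by linarith : (0 : ℝ) ≤ ℓ) (by nlinarith : (0 : ℝ) ≤ ℓ ^ 2 - 4)]
    linarith

/-- The sequence of dyadic grid points with prescribed exponents. -/
noncomputable def dyadicSeq {L H : ℕ} (κ : Fin L → Fin H) (l : ℕ) : ℝ :=
  if h : l < L then 2 ^ (κ ⟨l, h⟩ : ℕ) / L else 1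

lemma dyadicSeq_pos {L H : ℕ} (κ : Fin L → Fin H) {l : ℕ} (hl : l < L) : 0 < dyadicSeq κ l := by
  have hL : (0 : ℝ) < L := by exact_mod_cast (by omega : 0 < L)
  rw [dyadicSeq, dif_pos hl]; positivity

lemma exists_dyadicSeq_near {L n : ℕ} (hL : 0 < L) {x : ℕ → ℝ} (hx : ∀ l < L, 1 ≤ L * x l)
    (hxn : ∀ l < L, 2 * (L * x l) ≤ (n : ℝ) ^ 4) :
    ∃ κ : Fin L → Fin (Nat.log 2 (n ^ 4) + 1), ∀ l < L,
      x l ≤ dyadicSeq κ l ∧ dyadicSeq κ l ≤ 2 * x l := by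
  choose κ hκ using fun l : Fin L => exists_dyadic_near hL (hx l l.2) (hxn l l.2)
  refine ⟨κ, fun l hl => ?_⟩
  rw [dyadicSeq, dif_pos hl]
  exact hκ ⟨l, hl⟩

lemma sum_rpow_cube_le {L : ℕ} {T T' : ℕ → ℝ} (hT : ∀ l < L, 0 ≤ T l) (hT' : ∀ l < L, 0 ≤ T' l)
    (h : ∀ l < L, T' l ≤ 8 * T l) :
    (∑ l ∈ Finset.range L, T' l ^ ((2 : ℝ) / 3)) ^ 3 ≤
      64 * (∑ l ∈ Finset.range L, T l ^ ((2 : ℝ) / 3)) ^ 3 := by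
  have h8 : (8 : ℝ) ^ ((2 : ℝ) / 3) = 4 := by
    rw [show (8 : ℝ) = 2 ^ (3 : ℝ) by norm_num, ← Real.rpow_mul (by norm_num)]
    norm_num
  have h1 : ∑ l ∈ Finset.range L, T' l ^ ((2 : ℝ) / 3) ≤
      4 * ∑ l ∈ Finset.range L, T l ^ ((2 : ℝ) / 3) := by
    rw [Finset.mul_sum]
    refine Finset.sum_le_sum fun l hl => ?_
    have hl := Finset.mem_range.1 hl
    rw [← h8, ← Real.mul_rpow (by norm_num) (hT l hl)]
    exact Real.rpow_le_rpow (hT' l hl) (h l hl) (by norm_num)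
  calc _ ≤ (4 * ∑ l ∈ Finset.range L, T l ^ ((2 : ℝ) / 3)) ^ 3 :=
        pow_le_pow_left₀ (Finset.sum_nonneg fun l hl =>
          Real.rpow_nonneg (hT' l (Finset.mem_range.1 hl)) _) h1 3
    _ = _ := by ring

lemma le_sqrt_sum_cube {L : ℕ} {T : ℕ → ℝ} (hT : ∀ l < L, 0 ≤ T l) {l : ℕ} (hl : l < L) :
    T l ^ 2 ≤ (∑ l ∈ Finset.range L, T l ^ ((2 : ℝ) / 3)) ^ 3 := by
  have h1 : T l ^ ((2 : ℝ) / 3) ≤ ∑ l ∈ Finset.range L, T l ^ ((2 : ℝ) / 3) :=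
    Finset.single_le_sum (f := fun l => T l ^ ((2 : ℝ) / 3))
      (fun l hl => Real.rpow_nonneg (hT l (Finset.mem_range.1 hl)) _) (Finset.mem_range.2 hl)
  refine le_trans (le_of_eq ?_) (pow_le_pow_left₀ (Real.rpow_nonneg (hT l hl) _) h1 3)
  rw [← Real.rpow_natCast (T l ^ _), ← Real.rpow_mul (hT l hl), ← Real.rpow_natCast (T l)]
  norm_num

/-- The square of the class bound is dominated by the sum of the squares of the error terms. -/
lemma class_cost_le {n L H : ℕ} (hn : 9 ≤ n) (hH : 0 < H) {S S' Q W Λ δ : ℝ} (hS : 0 ≤ S) (hW : 1 ≤ W)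
    (hQ : Real.log (7 * W * n) ≤ Q) (hS' : S' ^ 3 ≤ 64 * S ^ 3) (hδ : 0 < δ) (hδ1 : δ < 1)
    (hcost : 2 * Real.log (2 * n + 1) + 6 * L * Real.log (H : ℝ) ≤
      2 * 10 ^ 6 * S ^ 3 * Real.log n ^ 3 + 9 * Λ) :
    2 * (Real.log (2 * n + 1) + 1024 * S' ^ 3 * Real.log (1 + 4 * n ^ 2 * W) +
        Real.log (1 / (δ / ((H : ℝ) ^ L) ^ 3))) ≤
      1536 ^ 2 * S ^ 3 * Q * Real.log n ^ 2 + 9 / 2 * Real.log (2 / δ) + 9 * Λ := by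
  have hn' : (9 : ℝ) ≤ n := by exact_mod_cast hn
  have hH' : (0 : ℝ) < H := by exact_mod_cast hH
  have hℓ := two_le_log_of_nine_le hn
  set ℓ := Real.log n with hℓdef
  have hS3 : 0 ≤ S ^ 3 := by positivity
  have hQℓ : ℓ ≤ Q := le_trans (Real.log_le_log (by positivity) (by nlinarith)) hQ
  have hP0 : 0 ≤ Real.log (1 + 4 * n ^ 2 * W) := Real.log_nonneg (by
    have : 0 ≤ 4 * (n : ℝ) ^ 2 * W := by positivity
    linarith)
  have hP : Real.log (1 + 4 * n ^ 2 * W) ≤ 2 * Q := by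
    have h1 : Real.log ((7 * W * n) ^ 2) = 2 * Real.log (7 * W * n) := by
      rw [Real.log_pow]; norm_num
    refine le_trans (Real.log_le_log (by positivity) ?_) (h1.le.trans (by linarith))
    have h2 : (1 : ℝ) ≤ n ^ 2 * W := by nlinarith
    have h3 : (n : ℝ) ^ 2 * W ≤ n ^ 2 * W ^ 2 := by
      have : W ≤ W ^ 2 := by nlinarith
      gcongr
    nlinarith
  have h1 : 2048 * S' ^ 3 * Real.log (1 + 4 * n ^ 2 * W) ≤ 262144 * (S ^ 3 * Q) := by
    calc 2048 * S' ^ 3 * Real.log (1 + 4 * n ^ 2 * W)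
        ≤ 2048 * (64 * S ^ 3) * (2 * Q) := by gcongr
      _ = _ := by ring
  have hlog : Real.log (1 / (δ / ((H : ℝ) ^ L) ^ 3)) = 3 * L * Real.log H + Real.log (1 / δ) := by
    rw [one_div_div, div_eq_mul_one_div, Real.log_mul (by positivity) (by positivity),
      Real.log_pow, Real.log_pow]
    push_cast; ring
  have hδ0 : 0 ≤ Real.log (1 / δ) := Real.log_nonneg (by rw [le_div_iff₀ hδ]; linarith)
  have hδ2 : Real.log (1 / δ) ≤ Real.log (2 / δ) :=
    Real.log_le_log (by positivity) (by gcongr; norm_num)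
  have hSQ : 0 ≤ S ^ 3 * Q := mul_nonneg hS3 (by linarith)
  have h2 : 4 * (S ^ 3 * Q) ≤ S ^ 3 * Q * ℓ ^ 2 := by
    have : 4 ≤ ℓ ^ 2 := by nlinarith
    rw [mul_comm]; gcongr
  have h3 : S ^ 3 * ℓ ^ 3 ≤ S ^ 3 * Q * ℓ ^ 2 := by
    calc S ^ 3 * ℓ ^ 3 = S ^ 3 * ℓ * ℓ ^ 2 := by ring
      _ ≤ _ := by gcongr
  rw [hlog]
  nlinarith

/-- Assembling the error terms. -/
lemma sqrt_cost_le {n : ℕ} (hn : 0 < n) {X cap S Q Λ ℓ D : ℝ} (hcap : 0 ≤ cap)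
    (hcap2 : cap ^ 2 = S ^ 3) (hQ : 0 ≤ Q) (hℓ : 0 ≤ ℓ) (hD : 0 ≤ D) (hΛ : 0 ≤ Λ)
    (h : 2 * X ≤ 1536 ^ 2 * S ^ 3 * Q * ℓ ^ 2 + 9 / 2 * D + 9 * Λ) :
    Real.sqrt (2 * X / n) ≤ 1536 / Real.sqrt n * cap * Real.sqrt Q * ℓ +
      3 * Real.sqrt (D / (2 * n)) + 3 * Real.sqrt (1 / n * Λ) := by
  have hn' : (0 : ℝ) < n := by exact_mod_cast hn
  set p := 1536 / Real.sqrt n * cap * Real.sqrt Q * ℓ with hp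
  set q := 3 * Real.sqrt (D / (2 * n)) with hq
  set r := 3 * Real.sqrt (1 / n * Λ) with hr
  have hp0 : 0 ≤ p := by positivity
  have hq0 : 0 ≤ q := by positivity
  have hr0 : 0 ≤ r := by positivity
  have hp2 : p ^ 2 = 1536 ^ 2 * S ^ 3 * Q * ℓ ^ 2 / n := by
    rw [hp, mul_pow, mul_pow, mul_pow, div_pow, Real.sq_sqrt hQ, Real.sq_sqrt hn'.le, hcap2]
    ring
  have hq2 : q ^ 2 = 9 / 2 * D / n := by
    rw [hq, mul_pow, Real.sq_sqrt (by positivity)]; field_simp; ring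
  have hr2 : r ^ 2 = 9 * Λ / n := by
    rw [hr, mul_pow, Real.sq_sqrt (by positivity)]; field_simp; ring
  refine Real.sqrt_le_iff.2 ⟨by positivity, ?_⟩
  have h1 : 2 * X / n ≤ p ^ 2 + q ^ 2 + r ^ 2 := by
    rw [hp2, hq2, hr2, ← add_div, ← add_div]; gcongr
  nlinarith [mul_nonneg hp0 hq0, mul_nonneg hp0 hr0, mul_nonneg hq0 hr0]

lemma cube_le_of_main_le_one {n : ℕ} (hn : 0 < n) {cap S Q ℓ : ℝ} (hcap : 0 ≤ cap) (hS : 0 ≤ S)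
    (hcap2 : cap ^ 2 = S ^ 3) (hQ : 1 ≤ Q) (hℓ : 1 ≤ ℓ)
    (h : 1536 / Real.sqrt n * cap * Real.sqrt Q * ℓ ≤ 1) : 16384 * S ^ 3 ≤ n := by
  have hn' : (0 : ℝ) < n := by exact_mod_cast hn
  have h2 : (1536 / Real.sqrt n * cap * Real.sqrt Q * ℓ) ^ 2 =
      1536 ^ 2 * S ^ 3 * Q * ℓ ^ 2 / n := by
    rw [mul_pow, mul_pow, mul_pow, div_pow, Real.sq_sqrt (by linarith : 0 ≤ Q),
      Real.sq_sqrt hn'.le, hcap2]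
    ring
  have h3 := pow_le_one₀ (n := 2) (by positivity) h
  rw [h2, div_le_one hn'] at h3
  have h4 : S ^ 3 * 1 * 1 ≤ S ^ 3 * Q * ℓ ^ 2 := by
    gcongr
    exact one_le_pow₀ hℓ
  have h5 : 0 ≤ S ^ 3 := by positivity
  linarith

namespace ConvNet

variable {net : ConvNet}

lemma rhoPlus_nonneg (A : ∀ l, net.Wt l) {B : ℕ → ℝ} (hB : ∀ l ≤ net.L, 0 < B l) {l : ℕ}
    (hl : l ≤ net.L) : 0 ≤ net.rhoPlus A B l :=
  Real.iSup_nonneg fun k => div_nonneg (lipConst_nonneg _ _ _) (hB _ (by omega)).le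

lemma LipNonlin.one_div_le_rhoPlus (hG : net.LipNonlin) (A : ∀ l, net.Wt l) {B : ℕ → ℝ} {l : ℕ}
    (hl : l < net.L) (hB : 0 < B l) : 1 / B l ≤ net.rhoPlus A B l := by
  refine le_trans ?_ (lipConst_div_le_rhoPlus A B (show l + 0 ≤ net.L by omega))
  have := hG.one_le_lipConst_zero A hl.le ⟨0, net.O_pos l hl⟩ ⟨0, net.d_pos l hl⟩
  rw [add_zero]
  gcongr

/-- The factor of layer `l + 1` in the capacity. -/
noncomputable def layerTerm (M A : ∀ l, net.Wt l) (B : ℕ → ℝ) (l : ℕ) : ℝ :=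
  (net.norm21 l (A l - M l) + 1 / net.L) * (B l + 1 / net.L) *
      (net.rhoPlus A B (l + 1) + 1 / net.L)

section Bounds

variable {M A : ∀ l, net.Wt l} {B : ℕ → ℝ}

lemma one_div_sq_le_layerTerm (hB : ∀ l < net.L, 1 ≤ B l) (hγ : 0 < B net.L) {l : ℕ}
    (hl : l < net.L) : 1 / (net.L : ℝ) ^ 2 ≤ layerTerm M A B l := by
  have hL : (0 : ℝ) < net.L := by exact_mod_cast net.L_pos
  have h1 := net.norm21_nonneg l (A l - M l)
  have h2 := rhoPlus_nonneg A (B := B) (fun i hi => by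
    rcases hi.lt_or_eq with h | h
    · linarith [hB i h]
    · exact h ▸ hγ) (show l + 1 ≤ net.L from hl)
  have h3 := hB l hl
  have h4 : (0 : ℝ) < 1 / net.L := by positivity
  calc 1 / (net.L : ℝ) ^ 2 = 1 / net.L * 1 * (1 / net.L) := by field_simp
    _ ≤ _ := by unfold layerTerm; gcongr <;> linarith

lemma LipNonlin.ratio_le_layerTerm (hG : net.LipNonlin) (hB : ∀ l < net.L, 1 ≤ B l) {l : ℕ}
    (hl : l + 1 < net.L) : B l / B (l + 1) ≤ net.L * layerTerm M A B l := by
  have hL : (0 : ℝ) < net.L := by exact_mod_cast net.L_pos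
  have h1 := net.norm21_nonneg l (A l - M l)
  have hB1 := hB (l + 1) hl
  have h2 := hG.one_div_le_rhoPlus A hl (B := B) (by linarith)
  have h3 := hB l (by omega)
  have h4 : (0 : ℝ) < 1 / net.L := by positivity
  calc B l / B (l + 1) = net.L * (1 / net.L * B l * (1 / B (l + 1))) := by field_simp
    _ ≤ _ := by unfold layerTerm; gcongr <;> linarith

lemma capacity_eq : net.capacity M A B =
    (∑ l ∈ Finset.range net.L, layerTerm M A B l ^ ((2 : ℝ) / 3)) ^ ((3 : ℝ) / 2) := rfl

lemma logSum_ge (hB : ∀ l < net.L, 1 ≤ B l) (hγ : 0 < B net.L) :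
    Real.log (2 + B (net.L - 1) / net.L) + (3 * net.L - 1) * Real.log 2 ≤ net.logSum M A B := by
  have hL : (0 : ℝ) < net.L := by exact_mod_cast net.L_pos
  have hlog : ∀ t : ℝ, 0 ≤ t → Real.log 2 ≤ Real.log (2 + t / net.L) := fun t ht =>
    Real.log_le_log two_pos (by
      have : 0 ≤ t / net.L := by positivity
      linarith)
  have hρ : ∀ l < net.L, 0 ≤ net.rhoPlus A B (l + 1) := fun l hl =>
    rhoPlus_nonneg A (fun i hi => by
      rcases hi.lt_or_eq with h | h
      · linarith [hB i h]
      · exact h ▸ hγ) hl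
  unfold logSum
  obtain ⟨k, hk⟩ : ∃ k, net.L = k + 1 := ⟨net.L - 1, by have := net.L_pos; omega⟩
  have hlast : net.L - 1 = k := by omega
  have hcast : (net.L : ℝ) = k + 1 := by exact_mod_cast hk
  rw [hlast]
  have hrange : Finset.range net.L = Finset.range (k + 1) := by rw [hk]
  rw [hrange, Finset.sum_range_succ]
  have h1 : (k : ℝ) * (3 * Real.log 2) ≤ ∑ l ∈ Finset.range k,
      (Real.log (2 + B l / net.L) + Real.log (2 + net.norm21 l (A l - M l) / net.L) +
      Real.log (2 + net.rhoPlus A B (l + 1) / net.L)) := by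
    have := Finset.card_nsmul_le_sum (Finset.range k) (fun l =>
      (Real.log (2 + B l / net.L) + Real.log (2 + net.norm21 l (A l - M l) / net.L) +
      Real.log (2 + net.rhoPlus A B (l + 1) / net.L))) (3 * Real.log 2) (fun l hl => by
        have hl' : l < net.L := by have := Finset.mem_range.1 hl; omega
        linarith [hlog _ (zero_le_one.trans (hB l hl')), hlog _ (net.norm21_nonneg l (A l - M l)),
          hlog _ (hρ l hl')])
    simpa using this
  have h2 := hlog _ (net.norm21_nonneg k (A k - M k))
  have h3 := hlog _ (hρ k (by omega))
  have h4 : (3 * (net.L : ℝ) - 1) * Real.log 2 = k * (3 * Real.log 2) + 2 * Real.log 2 := by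
    rw [hcast]; ring
  rw [h4]
  linarith

lemma Gam_nonneg (hB : ∀ l < net.L, 1 ≤ B l) (hγ : 0 < B net.L) : 0 ≤ net.Gam M A B := by
  refine Real.iSup_nonneg fun l => ?_
  have hL : (0 : ℝ) < net.L := by exact_mod_cast net.L_pos
  have h1 := net.norm21_nonneg l (A l - M l)
  have h2 := hB l l.2
  have h3 := rhoPlus_nonneg A (B := B) (fun i hi => by
      rcases hi.lt_or_eq with h | h
      · linarith [hB i h]
      · exact h ▸ hγ) (show (l : ℕ) + 1 ≤ net.L from l.2)
  positivity

/-- In the regime where the bound is not vacuous, the network belongs to a class of the grid with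
comparable capacity. -/
lemma exists_grid_class {n : ℕ} (hB : ∀ l < net.L, 1 ≤ B l) (hγ : 0 < B net.L)
    (hLn : 18 * (net.L : ℝ) ≤ n) {S : ℝ}
    (hS : S = ∑ l ∈ Finset.range net.L, layerTerm M A B l ^ ((2 : ℝ) / 3)) (hSn : S ^ 3 ≤ n) :
    ∃ κ : Fin 3 → Fin net.L → Fin (Nat.log 2 (n ^ 4) + 1),
      (A, B) ∈ boundedClass M (dyadicSeq (κ 0)) (dyadicSeq (κ 1)) (dyadicSeq (κ 2)) ∧
      (∑ l ∈ Finset.range net.L, (dyadicSeq (κ 0) l * dyadicSeq (κ 1) l * dyadicSeq (κ 2) l) ^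
        ((2 : ℝ) / 3)) ^ 3 ≤ 64 * S ^ 3 := by
  have hL : (0 : ℝ) < net.L := by exact_mod_cast net.L_pos
  have hL1 : (1 : ℝ) ≤ net.L := by exact_mod_cast net.L_pos
  have hL4 : (0 : ℝ) < 1 / net.L := by positivity
  set α : ℕ → ℝ := fun l => net.norm21 l (A l - M l) + 1 / net.L with hα
  set β : ℕ → ℝ := fun l => B l + 1 / net.L with hβ
  set ρ : ℕ → ℝ := fun l => net.rhoPlus A B (l + 1) + 1 / net.L with hρ
  have hT : ∀ l, layerTerm M A B l = α l * β l * ρ l := fun l => rfl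
  have hα1 : ∀ l < net.L, 1 / net.L ≤ α l := fun l _ => by
    have := net.norm21_nonneg l (A l - M l)
    simp only [hα]; linarith
  have hβ1 : ∀ l < net.L, 1 ≤ β l := fun l hl => by
    have := hB l hl
    simp only [hβ]; linarith
  have hρ1 : ∀ l < net.L, 1 / net.L ≤ ρ l := fun l hl => by
    have := rhoPlus_nonneg A (B := B) (fun i hi => by
      rcases hi.lt_or_eq with h | h
      · linarith [hB i h]
      · exact h ▸ hγ) (show (l : ℕ) + 1 ≤ net.L from hl)
    simp only [hρ]; linarith
  have hT0 : ∀ l < net.L, 0 ≤ layerTerm M A B l := fun l hl =>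
    le_trans (by positivity) (one_div_sq_le_layerTerm hB hγ hl)
  have hTn : ∀ l < net.L, α l * β l * ρ l ≤ n := fun l hl => by
    have h1 := le_sqrt_sum_cube hT0 hl
    rw [← hS] at h1
    have hn1 : (1 : ℝ) ≤ n := by linarith
    rw [← hT]
    exact abs_le_of_sq_le_sq' (by nlinarith) (by linarith) |>.2
  -- all three parameters lie in the range of the grid
  have key : ∀ t : ℝ, 0 ≤ t → t ≤ net.L ^ 2 * n → 2 * (net.L * t) ≤ (n : ℝ) ^ 4 := by
    intro t _ ht
    have hLn' : (net.L : ℝ) ≤ n / 18 := by linarith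
    calc 2 * (net.L * t) ≤ 2 * (net.L * (net.L ^ 2 * n)) := by gcongr
      _ ≤ 2 * ((n / 18) * ((n / 18) ^ 2 * n)) := by gcongr
      _ = 2 / 18 ^ 3 * (n : ℝ) ^ 4 := by ring
      _ ≤ _ := by nlinarith [pow_nonneg (Nat.cast_nonneg n : (0 : ℝ) ≤ n) 4]
  have hαb : ∀ l < net.L, α l ≤ net.L ^ 2 * n := fun l hl => by
    have h1 := hα1 l hl; have h2 := hβ1 l hl; have h3 := hρ1 l hl
    have hα0 := hL4.le.trans h1; have hβ0 := zero_le_one.trans h2; have hρ0 := hL4.le.trans h3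
    calc α l = net.L * (α l * 1 * (1 / net.L)) := by field_simp
      _ ≤ net.L * (α l * β l * ρ l) := by gcongr
      _ ≤ net.L ^ 2 * n := by
        refine mul_le_mul (by nlinarith) (hTn l hl) (by positivity) (by positivity)
  have hβb : ∀ l < net.L, β l ≤ net.L ^ 2 * n := fun l hl => by
    have h1 := hα1 l hl; have h2 := hβ1 l hl; have h3 := hρ1 l hl
    have hα0 := hL4.le.trans h1; have hβ0 := zero_le_one.trans h2; have hρ0 := hL4.le.trans h3
    calc β l = net.L ^ 2 * (1 / net.L * β l * (1 / net.L)) := by field_simp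
      _ ≤ net.L ^ 2 * (α l * β l * ρ l) := by gcongr
      _ ≤ net.L ^ 2 * n := by gcongr; exact hTn l hl
  have hρb : ∀ l < net.L, ρ l ≤ net.L ^ 2 * n := fun l hl => by
    have h1 := hα1 l hl; have h2 := hβ1 l hl; have h3 := hρ1 l hl
    have hα0 := hL4.le.trans h1; have hβ0 := zero_le_one.trans h2; have hρ0 := hL4.le.trans h3
    calc ρ l = net.L * (1 / net.L * 1 * ρ l) := by field_simp
      _ ≤ net.L * (α l * β l * ρ l) := by gcongr
      _ ≤ net.L ^ 2 * n := by
        refine mul_le_mul (by nlinarith) (hTn l hl) (by positivity) (by positivity)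
  have hinv : ∀ t : ℝ, 1 / net.L ≤ t → 1 ≤ net.L * t := fun t ht => by
    rw [div_le_iff₀ hL] at ht; linarith
  obtain ⟨κ₀, h₀⟩ := exists_dyadicSeq_near (n := n) net.L_pos (fun l hl => hinv _ (hα1 l hl))
    (fun l hl => key _ (hL4.le.trans (hα1 l hl)) (hαb l hl))
  obtain ⟨κ₁, h₁⟩ := exists_dyadicSeq_near (n := n) net.L_pos
    (fun l hl => le_trans hL1 (le_mul_of_one_le_right hL.le (hβ1 l hl)))
    (fun l hl => key _ (by linarith [hβ1 l hl]) (hβb l hl))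
  obtain ⟨κ₂, h₂⟩ := exists_dyadicSeq_near (n := n) net.L_pos (fun l hl => hinv _ (hρ1 l hl))
    (fun l hl => key _ (hL4.le.trans (hρ1 l hl)) (hρb l hl))
  refine ⟨![κ₀, κ₁, κ₂], ⟨fun l hl => ?_, fun l hl => ⟨?_, ?_⟩, hγ, fun l hl => ?_⟩, ?_⟩
  · exact le_trans (by simp only [hα]; linarith) (h₀ l hl).1
  · linarith [hB l hl]
  · exact le_trans (by simp only [hβ]; linarith) (h₁ l hl).1
  · exact le_trans (by simp only [hρ]; linarith) (h₂ l hl).1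
  · rw [hS]
    simp only [Matrix.cons_val_zero, Matrix.cons_val_one, Matrix.cons_val]
    refine sum_rpow_cube_le hT0 (fun l hl => ?_) fun l hl => ?_
    · exact (mul_pos (mul_pos (dyadicSeq_pos _ hl) (dyadicSeq_pos _ hl)) (dyadicSeq_pos _ hl)).le
    · rw [hT]
      have hα0 : 0 ≤ α l := hL4.le.trans (hα1 l hl)
      have hβ0 : 0 ≤ β l := by linarith [hβ1 l hl]
      have hρ0 := dyadicSeq_pos κ₂ hl
      have hβ0' := dyadicSeq_pos κ₁ hl
      calc dyadicSeq κ₀ l * dyadicSeq κ₁ l * dyadicSeq κ₂ l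
          ≤ (2 * α l) * (2 * β l) * (2 * ρ l) :=
            mul_le_mul (mul_le_mul (h₀ l hl).2 (h₁ l hl).2 hβ0'.le (by positivity))
              (h₂ l hl).2 hρ0.le (by positivity)
        _ = _ := by ring

end Bounds

lemma goodSet_empiricalB {n : ℕ} (s : Fin n → net.Act 0 × net.Label) (A : ∀ l, net.Wt l) (γ : ℝ) :
    net.goodSet s A γ (net.empiricalB s A γ) = {i | net.margin A (s i).1 (s i).2 > γ} := by
  ext i
  refine ⟨fun h => h.1, fun h => ⟨h, fun l hl => ?_⟩⟩
  rw [empiricalB, if_pos hl]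
  exact le_max_of_le_left (le_ciSup (f := fun i => net.patchNorm l (net.F A l (s i).1))
    (Set.finite_range _).bddAbove i)

open MeasureTheory

/-- A single event on which the bounds for all the classes of the grid hold. -/
lemma LipNonlin.exists_event_grid (hG : net.LipNonlin) (hK : 2 ≤ net.U net.L)
    (hout : ∀ p : Fin (net.U net.L) × Fin (net.w net.L), ∃ o i, net.patch net.L o i = p)
    (M : ∀ l, net.Wt l) {n : ℕ} (hn : 0 < n) (H : ℕ) (hH : 0 < H)
    (μ : Measure (net.Act 0 × net.Label)) [IsProbabilityMeasure μ]
    (δ : ℝ) (hδ : 0 < δ) (hδ1 : δ < 1) :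
    ∃ Ev : Set (Fin n → net.Act 0 × net.Label), MeasurableSet Ev ∧
      ENNReal.ofReal (1 - δ) ≤ (Measure.pi fun _ : Fin n => μ) Ev ∧
      ∀ s ∈ Ev, ∀ κ : Fin 3 → Fin net.L → Fin H, ∀ S : ℝ,
        S = ∑ l ∈ Finset.range net.L, (dyadicSeq (κ 0) l * dyadicSeq (κ 1) l *
          dyadicSeq (κ 2) l) ^ ((2 : ℝ) / 3) → 256 * S ^ 3 ≤ n →
        ∀ θ ∈ boundedClass M (dyadicSeq (κ 0)) (dyadicSeq (κ 1)) (dyadicSeq (κ 2)),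
          (μ (net.errorSet θ.1)).toReal ≤
          ((n : ℝ) - ((net.goodSet s θ.1 (θ.2 net.L) θ.2).ncard : ℝ)) / n +
          Real.sqrt (2 * (Real.log (2 * n + 1) +
            1024 * S ^ 3 * Real.log (1 + 4 * n ^ 2 * net.maxPreWidth) +
              Real.log (1 / (δ / ((H : ℝ) ^ net.L) ^ 3))) / n) := by
  have hH' : (1 : ℝ) ≤ H := by exact_mod_cast hH
  have hc1 : 1 ≤ ((H : ℝ) ^ net.L) ^ 3 := one_le_pow₀ (one_le_pow₀ hH')
  set δ' := δ / ((H : ℝ) ^ net.L) ^ 3 with hδ'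
  have hδ'0 : 0 < δ' := by positivity
  have hδ'1 : δ' < 1 := lt_of_le_of_lt (div_le_self hδ.le hc1) hδ1
  have hex : ∀ κ : Fin 3 → Fin net.L → Fin H,
      ∃ Ev : Set (Fin n → net.Act 0 × net.Label), MeasurableSet Ev ∧
      (Measure.pi fun _ : Fin n => μ) Evᶜ ≤ ENNReal.ofReal δ' ∧
      ∀ s ∈ Ev, ∀ S : ℝ,
        S = ∑ l ∈ Finset.range net.L, (dyadicSeq (κ 0) l * dyadicSeq (κ 1) l *
          dyadicSeq (κ 2) l) ^ ((2 : ℝ) / 3) → 256 * S ^ 3 ≤ n →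
        ∀ θ ∈ boundedClass M (dyadicSeq (κ 0)) (dyadicSeq (κ 1)) (dyadicSeq (κ 2)),
          (μ (net.errorSet θ.1)).toReal ≤
          ((n : ℝ) - ((net.goodSet s θ.1 (θ.2 net.L) θ.2).ncard : ℝ)) / n +
          Real.sqrt (2 * (Real.log (2 * n + 1) +
            1024 * S ^ 3 * Real.log (1 + 4 * n ^ 2 * net.maxPreWidth) +
              Real.log (1 / δ')) / n) := by
    intro κ
    set S₀ := ∑ l ∈ Finset.range net.L, (dyadicSeq (κ 0) l * dyadicSeq (κ 1) l *
          dyadicSeq (κ 2) l) ^ ((2 : ℝ) / 3) with hS₀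
    by_cases hcap : 256 * S₀ ^ 3 ≤ n
    · obtain ⟨Ev, h1, h2, h3⟩ := hG.exists_event_of_capacity hK hout M
        (fun l hl => dyadicSeq_pos (κ 0) hl) (fun l hl => dyadicSeq_pos (κ 1) hl)
        (fun l hl => dyadicSeq_pos (κ 2) hl) hn hS₀ hcap μ δ' hδ'0 hδ'1
      refine ⟨Ev, h1, h2, fun s hs S hS _ => ?_⟩
      rw [hS]
      exact h3 s hs
    · exact ⟨Set.univ, MeasurableSet.univ, by simp, fun s _ S hS hSn => absurd (hS ▸ hSn) hcap⟩
  choose Ev h1 h2 h3 using hex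
  refine ⟨⋂ κ, Ev κ, MeasurableSet.iInter h1, ?_, fun s hs κ => h3 κ s (Set.mem_iInter.1 hs κ)⟩
  have hcompl : (Measure.pi fun _ : Fin n => μ) (⋂ κ, Ev κ)ᶜ ≤ ENNReal.ofReal δ := by
    rw [Set.compl_iInter]
    refine (measure_iUnion_fintype_le _ _).trans ((Finset.sum_le_sum fun κ _ => h2 κ).trans ?_)
    rw [Finset.sum_const, nsmul_eq_mul, Finset.card_univ, Fintype.card_fun, Fintype.card_fun,
      Fintype.card_fin, Fintype.card_fin, Fintype.card_fin, ← ENNReal.ofReal_natCast,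
      ← ENNReal.ofReal_mul (by positivity)]
    refine ENNReal.ofReal_le_ofReal (le_of_eq ?_)
    push_cast
    rw [hδ']; field_simp
  have h4 := prob_compl_eq_one_sub (μ := Measure.pi fun _ : Fin n => μ) (MeasurableSet.iInter h1)
  rw [h4, tsub_le_iff_right] at hcompl
  rw [ENNReal.ofReal_sub _ hδ.le, ENNReal.ofReal_one, tsub_le_iff_right]
  rwa [add_comm]

end ConvNet

theorem conv_generalisation_post_hoc
    (net : ConvNet)
    (hK : 2 ≤ net.U net.L)
    -- every class score belongs to some layer-`L` patch, so that `|·|_L` is a norm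
    (hout : ∀ p : Fin (net.U net.L) × Fin (net.w net.L), ∃ o i, net.patch net.L o i = p)
    -- the nonlinearities are 1-Lipschitz and do not pool over different channels
    (hG : ∀ l, l < net.L → ∀ z z' : net.PreAct l,
      net.pixelNorm (l + 1) (net.G l z - net.G l z') ≤ net.preNorm l (z - z'))
    (n : ℕ) (hn : 0 < n)
    (μ : MeasureTheory.Measure (net.Act 0 × net.Label)) [MeasureTheory.IsProbabilityMeasure μ]
    (M : ∀ l, net.Wt l)
    (δ : ℝ) (hδ : 0 < δ) :
    (∃ E : Set (Fin n → net.Act 0 × net.Label), MeasurableSet E ∧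
      ENNReal.ofReal (1 - δ) ≤ (MeasureTheory.Measure.pi fun _ : Fin n => μ) E ∧
      ∀ s ∈ E, ∀ (A : ∀ l, net.Wt l) (γ : ℝ) (B : ℕ → ℝ), 0 < γ →
        (∀ l, l < net.L → 1 ≤ B l) → B net.L = γ →
        (μ (net.errorSet A)).toReal ≤
          ((n : ℝ) - ((net.goodSet s A γ B).ncard : ℝ)) / n
          + 8 / n
          + 1536 / Real.sqrt n * net.capacity M A B
              * Real.sqrt (Real.logb 2
                  (32 * net.Gam M A B * (n : ℝ) ^ 2 + 7 * net.maxPreWidth * n))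
              * Real.log n
          + 3 * Real.sqrt (Real.log (2 / δ) / (2 * n))
          + 3 * Real.sqrt (1 / n * net.logSum M A B)) ∧
    (∀ (s : Fin n → net.Act 0 × net.Label) (A : ∀ l, net.Wt l) (γ : ℝ),
      net.goodSet s A γ (net.empiricalB s A γ) =
        {i | net.margin A (s i).1 (s i).2 > γ}) := by
  have hG : net.LipNonlin := hG
  refine ⟨?_, fun s A γ => ConvNet.goodSet_empiricalB s A γ⟩
  rcases le_or_gt 1 δ with hδ1 | hδ1
  · exact ⟨∅, MeasurableSet.empty, by simp [ENNReal.ofReal_of_nonpos (sub_nonpos.2 hδ1)],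
      fun s hs => absurd hs (Set.notMem_empty s)⟩
  have hn' : (0 : ℝ) < n := by exact_mod_cast hn
  obtain ⟨E, hEm, hEμ, hE⟩ := hG.exists_event_grid hK hout M hn (Nat.log 2 (n ^ 4) + 1)
    (Nat.succ_pos _) μ δ hδ hδ1
  refine ⟨E, hEm, hEμ, fun s hs A γ B hγ hB hBL => ?_⟩
  subst hBL
  have hemp : 0 ≤ ((n : ℝ) - ((net.goodSet s A (B net.L) B).ncard : ℝ)) / n := by
    refine div_nonneg (sub_nonneg.2 ?_) hn'.le
    have := Set.ncard_le_ncard (Set.subset_univ (net.goodSet s A (B net.L) B))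
    rw [Set.ncard_univ, Nat.card_eq_fintype_card, Fintype.card_fin] at this
    exact_mod_cast this
  have hlogn : 0 ≤ Real.log n := Real.log_natCast_nonneg n
  set S := ∑ l ∈ Finset.range net.L, ConvNet.layerTerm M A B l ^ ((2 : ℝ) / 3) with hS
  have hT : ∀ l < net.L, 1 / (net.L : ℝ) ^ 2 ≤ ConvNet.layerTerm M A B l := fun l hl =>
    ConvNet.one_div_sq_le_layerTerm hB hγ hl
  have hS0 : 0 ≤ S := Finset.sum_nonneg fun l hl =>
    Real.rpow_nonneg (le_trans (by positivity) (hT l (Finset.mem_range.1 hl))) _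
  have hcap0 : 0 ≤ net.capacity M A B := Real.rpow_nonneg hS0 _
  have hcap2 : net.capacity M A B ^ 2 = S ^ 3 := by
    rw [ConvNet.capacity_eq, ← hS, ← Real.rpow_natCast (S ^ _), ← Real.rpow_mul hS0,
      ← Real.rpow_natCast S]
    norm_num
  set Q := Real.logb 2 (32 * net.Gam M A B * (n : ℝ) ^ 2 + 7 * net.maxPreWidth * n) with hQ
  set Λ := net.logSum M A B with hΛ
  set main := 1536 / Real.sqrt n * net.capacity M A B * Real.sqrt Q * Real.log n with hmain
  have hmain0 : 0 ≤ main := by positivity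
  set conf := 3 * Real.sqrt (Real.log (2 / δ) / (2 * n)) with hconf
  have hconf0 : 0 ≤ conf := by positivity
  set post := 3 * Real.sqrt (1 / n * Λ) with hpost
  have hpost0 : 0 ≤ post := by positivity
  have h8 : 0 < 8 / (n : ℝ) := by positivity
  by_contra hcon
  push Not at hcon
  have hle1 : (μ (net.errorSet A)).toReal ≤ 1 := by
    have := MeasureTheory.prob_le_one (μ := μ) (s := net.errorSet A)
    exact ENNReal.toReal_le_of_le_ofReal zero_le_one (by simpa using this)
  -- the bound is vacuous for small samples
  have hn9 : 9 ≤ n := by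
    by_contra h
    have h1 : (n : ℝ) ≤ 8 := by exact_mod_cast (by omega : n ≤ 8)
    have : 1 ≤ 8 / (n : ℝ) := by rw [le_div_iff₀ hn']; linarith
    linarith
  have hn9' : (9 : ℝ) ≤ n := by exact_mod_cast hn9
  have hℓ := two_le_log_of_nine_le hn9
  have hW := ConvNet.one_le_maxPreWidth (net := net)
  have hQlog : Real.log (7 * net.maxPreWidth * n) ≤ Q := by
    have hΓ := ConvNet.Gam_nonneg (M := M) (A := A) hB hγ
    have h1 : Real.log (7 * net.maxPreWidth * n) ≤
        Real.log (32 * net.Gam M A B * (n : ℝ) ^ 2 + 7 * net.maxPreWidth * n) :=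
      Real.log_le_log (by positivity) (by
        have : 0 ≤ 32 * net.Gam M A B * (n : ℝ) ^ 2 := by positivity
        linarith)
    have h2 : 0 ≤ Real.log (7 * net.maxPreWidth * n) := Real.log_nonneg (by nlinarith)
    rw [hQ, Real.logb, le_div_iff₀ (Real.log_pos one_lt_two)]
    nlinarith [Real.log_two_lt_d9]
  have hQℓ : Real.log n ≤ Q :=
    le_trans (Real.log_le_log hn' (by nlinarith)) hQlog
  have hΛge := ConvNet.logSum_ge (M := M) (A := A) hB hγ
  rw [← hΛ] at hΛge
  have hL1 : (1 : ℝ) ≤ net.L := by exact_mod_cast net.L_pos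
  have hΛL : 2 * (net.L : ℝ) ≤ Λ := by
    have hBl := hB (net.L - 1) (Nat.sub_lt net.L_pos one_pos)
    have h1 : Real.log 2 ≤ Real.log (2 + B (net.L - 1) / net.L) :=
      Real.log_le_log two_pos (by
        have : 0 ≤ B (net.L - 1) / net.L := by positivity
        linarith)
    nlinarith [Real.log_two_gt_d9]
  have hΛ0 : 0 ≤ Λ := by linarith
  have hLn : 18 * (net.L : ℝ) ≤ n := by
    have h1 : post ≤ 1 := by linarith
    have h2 : post ^ 2 = 9 * Λ / n := by
      rw [hpost, mul_pow, Real.sq_sqrt (by positivity)]; field_simp; ring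
    have h3 : 9 * Λ / n ≤ 1 := by rw [← h2]; exact pow_le_one₀ hpost0 h1
    rw [div_le_one hn'] at h3
    linarith
  have hSn : 16384 * S ^ 3 ≤ n :=
    cube_le_of_main_le_one hn hcap0 hS0 hcap2 (by linarith) (by linarith : 1 ≤ Real.log n)
      (show main ≤ 1 by linarith)
  have hS3 : 0 ≤ S ^ 3 := by positivity
  obtain ⟨κ, hκ, hκS⟩ := ConvNet.exists_grid_class (M := M) (A := A) hB hγ hLn hS (by linarith)
  have hbound := hE s hs κ _ rfl (by linarith) (A, B) hκ
  have hcost := union_cost_le net.L_pos hn9 hS hT hB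
    (fun l hl => hG.ratio_le_layerTerm hB hl) hΛge
  have htotal := class_cost_le hn9 (Nat.succ_pos _) hS0 hW hQlog hκS hδ hδ1 hcost
  have hD0 : 0 ≤ Real.log (2 / δ) := Real.log_nonneg (by rw [le_div_iff₀ hδ]; linarith)
  have hfinal := sqrt_cost_le hn hcap0 hcap2 (by linarith : 0 ≤ Q) hlogn hD0 hΛ0 htotal
  simp only at hbound
  linarith
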